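/- There exists μ₀ ∈ (0, 1/2] such that for every μ ∈ (0, μ₀) and every ε > 0 the planar circular restricted three-body problem with mass ratio μ has a periodic solution (q(t), p(t)) (defined for all t ∈ ℝ and of some period T > 0) satisfying sup_{t∈ℝ} ‖q(t)‖ ≥ ε⁻¹ and inf_{t∈ℝ} ‖q(t) + (μ,0)‖ ≤ ε. -/

import Mathlib

open Real Filter MeasureTheory
open scoped Topology

/-- Euclidean norm of a planar vector given by its components. -/
noncomputable def nrm2 (x y : ℝ) : ℝ := Real.sqrt (x ^ 2 + y ^ 2)

/-- Distance from `(x,y)` to the first (massive) primary, located at `(-μ,0)`. -/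
noncomputable def dS (μ x y : ℝ) : ℝ := Real.sqrt ((x + μ) ^ 2 + y ^ 2)

/-- Distance from `(x,y)` to the second primary, located at `(1-μ,0)`. -/
noncomputable def dJ (μ x y : ℝ) : ℝ := Real.sqrt ((x - (1 - μ)) ^ 2 + y ^ 2)

/-- `(q₁,q₂,p₁,p₂)` is a solution of the planar circular restricted three-body problem
with mass ratio `μ` on the set `I` of times: it avoids the two singularities and satisfies
Hamilton's equations `q̇ = ∂H/∂p`, `ṗ = -∂H/∂q` for the Hamiltonian
`H(q,p;μ) = ‖p‖²/2 - q₁p₂ + q₂p₁ - (1-μ)/‖q+(μ,0)‖ - μ/‖q-(1-μ,0)‖`,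
whose partial derivatives have been computed explicitly. -/
def IsPCRTBPSol (μ : ℝ) (I : Set ℝ) (q1 q2 p1 p2 : ℝ → ℝ) : Prop :=
  ∀ t ∈ I,
    ((q1 t, q2 t) ≠ (-μ, 0) ∧ (q1 t, q2 t) ≠ (1 - μ, 0)) ∧
    HasDerivAt q1 (p1 t + q2 t) t ∧
    HasDerivAt q2 (p2 t - q1 t) t ∧
    HasDerivAt p1 (p2 t - (1 - μ) * (q1 t + μ) / (dS μ (q1 t) (q2 t)) ^ 3
        - μ * (q1 t - (1 - μ)) / (dJ μ (q1 t) (q2 t)) ^ 3) t ∧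
    HasDerivAt p2 (-(p1 t) - (1 - μ) * (q2 t) / (dS μ (q1 t) (q2 t)) ^ 3
        - μ * (q2 t) / (dJ μ (q1 t) (q2 t)) ^ 3) t

section Flow

variable {E : Type*} [NormedAddCommGroup E] [NormedSpace ℝ E]

lemma hasDerivAt_glue {K : NNReal} {f : E → E} (hf : LipschitzWith K f) {γ₁ γ₂ : ℝ → E}
    {a b c d t₀ : ℝ} (ha : a < t₀) (hb : t₀ < b) (hc : c < t₀) (hd : t₀ < d)
    (h₁ : ∀ t ∈ Set.Ioo a b, HasDerivAt γ₁ (f (γ₁ t)) t)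
    (h₂ : ∀ t ∈ Set.Ioo c d, HasDerivAt γ₂ (f (γ₂ t)) t) (h₀ : γ₁ t₀ = γ₂ t₀) :
    ∀ t ∈ Set.Ioo a d, HasDerivAt (fun s => if s < t₀ then γ₁ s else γ₂ s)
      (f (if t < t₀ then γ₁ t else γ₂ t)) t := by
  intro t ht
  rcases lt_trichotomy t t₀ with h | h | h
  · have : (fun s => if s < t₀ then γ₁ s else γ₂ s) =ᶠ[𝓝 t] γ₁ := by
      filter_upwards [Iio_mem_nhds h] with s hs
      simp [show s < t₀ from hs]
    rw [this.hasDerivAt_iff, if_pos h]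
    exact h₁ t ⟨ht.1, h.trans hb⟩
  · subst h
    have hag : Set.EqOn γ₁ γ₂ (Set.Ioo (max a c) (min b d)) := by
      refine ODE_solution_unique_of_mem_Ioo (v := fun _ => f) (s := fun _ => Set.univ) (K := K)
        (t₀ := t) (fun _ _ => hf.lipschitzOnWith) ⟨max_lt ha hc, lt_min hb hd⟩ ?_ ?_ h₀
      · intro s hs
        exact ⟨h₁ s ⟨(le_max_left _ _).trans_lt hs.1, hs.2.trans_le (min_le_left _ _)⟩, trivial⟩
      · intro s hs
        exact ⟨h₂ s ⟨(le_max_right _ _).trans_lt hs.1, hs.2.trans_le (min_le_right _ _)⟩, trivial⟩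
    have : (fun s => if s < t then γ₁ s else γ₂ s) =ᶠ[𝓝 t] γ₂ := by
      filter_upwards [Ioo_mem_nhds (max_lt ha hc) (lt_min hb hd)] with s hs
      by_cases h : s < t
      · simp [h, hag hs]
      · simp [h]
    rw [this.hasDerivAt_iff, if_neg (lt_irrefl t)]
    exact h₂ t ⟨hc, hd⟩
  · have : (fun s => if s < t₀ then γ₁ s else γ₂ s) =ᶠ[𝓝 t] γ₂ := by
      filter_upwards [Ioi_mem_nhds h] with s hs
      simp [not_lt.2 (show t₀ < s from hs).le]
    rw [this.hasDerivAt_iff, if_neg (not_lt.2 h.le)]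
    exact h₂ t ⟨hc.trans h, ht.2⟩

variable [CompleteSpace E]

lemma exists_local_solution {K : NNReal} {f : E → E} (hf : LipschitzWith K f) (x : E) :
    ∃ γ : ℝ → E, γ 0 = x ∧
      ∀ t ∈ Set.Ioo (-(1 / (1 + (K : ℝ)))) (1 / (1 + (K : ℝ))), HasDerivAt γ (f (γ t)) t := by
  have hK : (0 : ℝ) < 1 + K := by positivity
  set τ : ℝ := 1 / (1 + (K : ℝ)) with hτ
  have hτ0 : 0 < τ := by positivity
  have hpl : IsPicardLindelof (fun _ : ℝ => f) (tmin := -τ) (tmax := τ)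
      ⟨0, by constructor <;> linarith⟩ x ‖f x‖₊ 0 ((1 + K) * ‖f x‖₊) K := by
    refine IsPicardLindelof.of_time_independent ?_ hf.lipschitzOnWith ?_
    · intro y hy
      have h1 : ‖f y - f x‖ ≤ K * ‖y - x‖ := hf.norm_sub_le y x
      have h2 : ‖y - x‖ ≤ ‖f x‖ := by simpa [dist_eq_norm] using hy
      have h3 : ‖f y‖ ≤ ‖f x‖ + ‖f y - f x‖ := by
        simpa using norm_add_le (f x) (f y - f x)
      have h4 : (K : ℝ) * ‖y - x‖ ≤ K * ‖f x‖ := by gcongr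
      push_cast
      linarith
    · simp only [sub_zero, zero_sub, neg_neg, max_self]
      push_cast
      rw [sub_zero, hτ]
      field_simp
      exact le_rfl
  obtain ⟨γ, h0, h⟩ := hpl.exists_eq_forall_mem_Icc_hasDerivWithinAt₀
  exact ⟨γ, h0, fun t ht => (h t ⟨ht.1.le, ht.2.le⟩).hasDerivAt (Icc_mem_nhds ht.1 ht.2)⟩

lemma exists_solution_Ioo {K : NNReal} {f : E → E} (hf : LipschitzWith K f) (n : ℕ) (x : E) :
    ∃ γ : ℝ → E, γ 0 = x ∧
      ∀ t ∈ Set.Ioo (-((1 + n / 2) * (1 / (1 + (K : ℝ))))) ((1 + n / 2) * (1 / (1 + (K : ℝ)))),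
        HasDerivAt γ (f (γ t)) t := by
  have hK : (0 : ℝ) < 1 + K := by positivity
  induction n with
  | zero => simpa using exists_local_solution hf x
  | succ n ih =>
    obtain ⟨γ, h0, h⟩ := ih
    push_cast
    set τ : ℝ := 1 / (1 + (K : ℝ)) with hτ
    have hτ0 : 0 < τ := by positivity
    set T : ℝ := (1 + n / 2) * τ with hT
    have hTτ : τ ≤ T := by
      have : (0 : ℝ) ≤ n / 2 * τ := by positivity
      rw [hT]; linarith
    have e1 : (1 + ((n : ℝ) + 1) / 2) * τ = T + τ / 2 := by rw [hT]; ring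
    rw [e1]
    obtain ⟨α, hα0, hα⟩ := exists_local_solution hf (γ (T - τ / 2))
    obtain ⟨β, hβ0, hβ⟩ := exists_local_solution hf (γ (-(T - τ / 2)))
    rw [← hτ] at hα hβ
    have hα' : ∀ t ∈ Set.Ioo (T - τ / 2 - τ) (T + τ / 2),
        HasDerivAt (fun s => α (s - (T - τ / 2))) (f (α (t - (T - τ / 2)))) t := fun t ht =>
      (hα _ ⟨by linarith [ht.1], by linarith [ht.2]⟩).comp_sub_const t (T - τ / 2)
    have hβ' : ∀ t ∈ Set.Ioo (-(T + τ / 2)) (-(T - τ / 2) + τ),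
        HasDerivAt (fun s => β (s - -(T - τ / 2))) (f (β (t - -(T - τ / 2)))) t := fun t ht =>
      (hβ _ ⟨by linarith [ht.1], by linarith [ht.2]⟩).comp_sub_const t (-(T - τ / 2))
    have g1 := hasDerivAt_glue hf (t₀ := T - τ / 2) (by linarith) (by linarith) (by linarith)
      (by linarith) h hα' (by simp [hα0])
    have g2 := hasDerivAt_glue hf (t₀ := -(T - τ / 2)) (by linarith) (by linarith) (by linarith)
      (by linarith) hβ' g1 (by
        simp only [sub_self]
        rw [if_pos (by linarith), hβ0])
    refine ⟨_, ?_, g2⟩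
    rw [if_neg (by linarith), if_pos (by linarith), h0]

lemma exists_global_solution {K : NNReal} {f : E → E} (hf : LipschitzWith K f) (x : E) :
    ∃ γ : ℝ → E, γ 0 = x ∧ ∀ t, HasDerivAt γ (f (γ t)) t := by
  have hK : (0 : ℝ) < 1 + K := by positivity
  choose γ h0 h using fun n => exists_solution_Ioo hf n x
  set T : ℕ → ℝ := fun n => (1 + n / 2) * (1 / (1 + (K : ℝ))) with hT
  have hTmono : Monotone T := by
    intro m n hmn
    have : (m : ℝ) ≤ n := by exact_mod_cast hmn
    simp only [hT]
    gcongr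
  have hTpos : ∀ n, 0 < T n := fun n => by simp only [hT]; positivity
  have hTbig : ∀ t : ℝ, ∃ n, t < T n := by
    intro t
    obtain ⟨n, hn⟩ := exists_nat_gt (2 * t * (1 + K))
    refine ⟨n, ?_⟩
    simp only [hT]
    rw [mul_one_div, lt_div_iff₀ hK]
    linarith
  have hag : ∀ m n, m ≤ n → Set.EqOn (γ m) (γ n) (Set.Ioo (-T m) (T m)) := by
    intro m n hmn
    refine ODE_solution_unique_of_mem_Ioo (v := fun _ => f) (s := fun _ => Set.univ) (K := K)
      (t₀ := 0) (fun _ _ => hf.lipschitzOnWith) ⟨by linarith [hTpos m], hTpos m⟩ ?_ ?_ (by simp [h0])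
    · exact fun t ht => ⟨h m t ht, trivial⟩
    · exact fun t ht => ⟨h n t ⟨(neg_le_neg (hTmono hmn)).trans_lt ht.1, ht.2.trans_le (hTmono hmn)⟩,
        trivial⟩
  choose N hN using fun t : ℝ => hTbig |t|
  have key : ∀ n t, |t| < T n → γ (N t) t = γ n t := by
    intro n t ht
    rcases le_total (N t) n with hh | hh
    · exact hag _ _ hh (abs_lt.1 (hN t))
    · exact (hag _ _ hh (abs_lt.1 ht)).symm
  refine ⟨fun t => γ (N t) t, h0 _, fun t => ?_⟩
  have : (fun t => γ (N t) t) =ᶠ[𝓝 t] γ (N t) := by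
    filter_upwards [continuous_abs.continuousAt.eventually_lt_const (hN t)] with s hs
    exact key _ _ hs
  rw [this.hasDerivAt_iff]
  exact h _ t (abs_lt.1 (hN t))

/-- The global flow of a Lipschitz vector field, jointly continuous in time and initial value. -/
lemma exists_global_flow {K : NNReal} {f : E → E} (hf : LipschitzWith K f) :
    ∃ φ : E → ℝ → E, (∀ x, φ x 0 = x) ∧ (∀ x t, HasDerivAt (φ x) (f (φ x t)) t) ∧
      Continuous (Function.uncurry φ) := by
  choose φ h0 h using exists_global_solution hf
  refine ⟨φ, h0, h, ?_⟩
  have hfwd : ∀ x y t, 0 ≤ t → dist (φ x t) (φ y t) ≤ dist x y * Real.exp (K * |t|) := by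
    intro x y t ht
    have := dist_le_of_trajectories_ODE (v := fun _ => f) (K := K) (a := 0) (b := t)
      (fun _ => hf) (fun s _ => (h x s).continuousAt.continuousWithinAt)
      (fun s _ => (h x s).hasDerivWithinAt) (fun s _ => (h y s).continuousAt.continuousWithinAt)
      (fun s _ => (h y s).hasDerivWithinAt) (by rw [h0, h0]) t ⟨ht, le_rfl⟩
    rw [abs_of_nonneg ht]
    rwa [sub_zero] at this
  have hr : ∀ x t, HasDerivAt (fun s => φ x (-s)) (-f (φ x (-t))) t := fun x t => by
    simpa [Function.comp_def] using (h x (-t)).scomp t (hasDerivAt_neg t)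
  have hbwd : ∀ x y t, 0 ≤ t → dist (φ x (-t)) (φ y (-t)) ≤ dist x y * Real.exp (K * |t|) := by
    intro x y t ht
    have := dist_le_of_trajectories_ODE (v := fun _ x => -f x) (K := K) (a := 0) (b := t)
      (fun _ => hf.neg) (fun s _ => (hr x s).continuousAt.continuousWithinAt)
      (fun s _ => (hr x s).hasDerivWithinAt) (fun s _ => (hr y s).continuousAt.continuousWithinAt)
      (fun s _ => (hr y s).hasDerivWithinAt) (δ := dist x y) (by simp [h0]) t ⟨ht, le_rfl⟩
    rw [abs_of_nonneg ht]
    rwa [sub_zero] at this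
  have hdist : ∀ x y t, dist (φ x t) (φ y t) ≤ dist x y * Real.exp (K * |t|) := by
    intro x y t
    rcases le_total 0 t with ht | ht
    · exact hfwd x y t ht
    · simpa using hbwd x y (-t) (by linarith)
  rw [continuous_iff_continuousAt]
  rintro ⟨x, t⟩
  rw [ContinuousAt, tendsto_iff_dist_tendsto_zero]
  have hb : ∀ p : E × ℝ, dist (Function.uncurry φ p) (Function.uncurry φ (x, t)) ≤
      dist p.1 x * Real.exp (K * |p.2|) + dist (φ x p.2) (φ x t) := fun p =>
    (dist_triangle _ (φ x p.2) _).trans (add_le_add (hdist _ _ _) le_rfl)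
  refine squeeze_zero (fun _ => dist_nonneg) hb ?_
  have hc : Continuous (φ x) := continuous_iff_continuousAt.2 fun s => (h x s).continuousAt
  have : Continuous fun p : E × ℝ =>
      dist p.1 x * Real.exp (K * |p.2|) + dist (φ x p.2) (φ x t) := by
    have := hc.comp (continuous_snd (X := E) (Y := ℝ))
    fun_prop
  simpa using this.tendsto (x, t)

end Flow

section Kernel

/-- The Newtonian kernel `z / ‖z‖ ^ 3`, truncated inside the disc of radius `c`. -/
noncomputable def truncKernel (c : ℝ) (z : ℂ) : ℂ := ((max ‖z‖ c ^ 3)⁻¹ : ℝ) • z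

lemma lipschitzWith_truncKernel {c : ℝ} (hc : 0 < c) :
    LipschitzWith (Real.toNNReal (4 / c ^ 3)) (truncKernel c) := by
  refine LipschitzWith.of_dist_le_mul fun z w => ?_
  rw [Real.coe_toNNReal _ (by positivity), dist_eq_norm, dist_eq_norm, truncKernel, truncKernel]
  set s := max ‖z‖ c with hs
  set t := max ‖w‖ c with ht
  have hsc : c ≤ s := le_max_right _ _
  have htc : c ≤ t := le_max_right _ _
  have hs0 : 0 < s := hc.trans_le hsc
  have ht0 : 0 < t := hc.trans_le htc
  have hst : |s - t| ≤ ‖z - w‖ :=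
    (abs_max_sub_max_le_abs _ _ _).trans (abs_norm_sub_norm_le z w)
  have hwt : ‖w‖ ≤ t := le_max_left _ _
  have e : ((s ^ 3)⁻¹ : ℝ) • z - ((t ^ 3)⁻¹ : ℝ) • w =
      ((s ^ 3)⁻¹ : ℝ) • (z - w) + ((s ^ 3)⁻¹ - (t ^ 3)⁻¹ : ℝ) • w := by
    rw [smul_sub, sub_smul]; abel
  have h1 : (s ^ 3)⁻¹ ≤ (c ^ 3)⁻¹ := by gcongr
  have h2 : |(s ^ 3)⁻¹ - (t ^ 3)⁻¹| * t ≤ 3 * (c ^ 3)⁻¹ * |s - t| := by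
    have e2 : (s ^ 3)⁻¹ - (t ^ 3)⁻¹ =
        (t - s) * ((s ^ 2 + s * t + t ^ 2) / (s ^ 3 * t ^ 3)) := by
      field_simp; ring
    rw [e2, abs_mul, abs_sub_comm t s,
      abs_of_nonneg (show 0 ≤ (s ^ 2 + s * t + t ^ 2) / (s ^ 3 * t ^ 3) by positivity)]
    have e3 : (s ^ 2 + s * t + t ^ 2) / (s ^ 3 * t ^ 3) * t =
        (s * t ^ 2)⁻¹ + (s ^ 2 * t)⁻¹ + (s ^ 3)⁻¹ := by
      field_simp
    have b1 : (s * t ^ 2)⁻¹ ≤ (c ^ 3)⁻¹ := by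
      have : c ^ 3 ≤ s * t ^ 2 := by
        calc c ^ 3 = c * c ^ 2 := by ring
          _ ≤ s * t ^ 2 := by gcongr
      gcongr
    have b2 : (s ^ 2 * t)⁻¹ ≤ (c ^ 3)⁻¹ := by
      have : c ^ 3 ≤ s ^ 2 * t := by
        calc c ^ 3 = c ^ 2 * c := by ring
          _ ≤ s ^ 2 * t := by gcongr
      gcongr
    rw [mul_assoc, e3, mul_comm]
    have := abs_nonneg (s - t)
    gcongr
    linarith
  have h3 : |(s ^ 3)⁻¹ - (t ^ 3)⁻¹| * ‖w‖ ≤ |(s ^ 3)⁻¹ - (t ^ 3)⁻¹| * t := by gcongr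
  have h4 : 3 * (c ^ 3)⁻¹ * |s - t| ≤ 3 * (c ^ 3)⁻¹ * ‖z - w‖ := by gcongr
  have h5 : (s ^ 3)⁻¹ * ‖z - w‖ ≤ (c ^ 3)⁻¹ * ‖z - w‖ := by gcongr
  calc _ ≤ (s ^ 3)⁻¹ * ‖z - w‖ + |(s ^ 3)⁻¹ - (t ^ 3)⁻¹| * ‖w‖ := by
        rw [e]
        refine (norm_add_le _ _).trans ?_
        rw [norm_smul, norm_smul, Real.norm_eq_abs, Real.norm_eq_abs,
          abs_of_pos (show (0 : ℝ) < (s ^ 3)⁻¹ by positivity)]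
    _ ≤ 4 / c ^ 3 * ‖z - w‖ := by
        rw [div_eq_mul_inv]; linarith

lemma truncKernel_conj (c : ℝ) (z : ℂ) :
    truncKernel c (starRingEnd ℂ z) = starRingEnd ℂ (truncKernel c z) := by
  simp [truncKernel, Complex.real_smul]

end Kernel

section Exit

/-- A continuous function of one variable that starts positive and becomes nonpositive has a first
zero. -/
lemma exists_first_zero {g : ℝ → ℝ} (hg : Continuous g) {a b : ℝ} (hab : a ≤ b) (ha : 0 < g a)
    (hb : g b ≤ 0) : ∃ t ∈ Set.Ioc a b, g t = 0 ∧ ∀ s ∈ Set.Ico a t, 0 < g s := by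
  set S : Set ℝ := {t | a ≤ t ∧ g t ≤ 0} with hS
  have hSc : IsClosed S := (isClosed_le continuous_const continuous_id).inter
    (isClosed_le hg continuous_const)
  have hSn : S.Nonempty := ⟨b, hab, hb⟩
  have hSb : BddBelow S := ⟨a, fun t ht => ht.1⟩
  have hmem : sInf S ∈ S := hSc.csInf_mem hSn hSb
  have hpos : ∀ s ∈ Set.Ico a (sInf S), 0 < g s := fun s hs => by
    by_contra! h
    exact absurd (csInf_le hSb (show s ∈ S from ⟨hs.1, h⟩)) (not_le.2 hs.2)
  have hlt : a < sInf S := by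
    refine lt_of_le_of_ne hmem.1 fun h => ?_
    have := hmem.2
    rw [← h] at this
    linarith
  refine ⟨sInf S, ⟨hlt, csInf_le hSb ⟨hab, hb⟩⟩, le_antisymm hmem.2 ?_, hpos⟩
  refine ge_of_tendsto (hg.continuousAt.tendsto.mono_left nhdsWithin_le_nhds :
    Tendsto g (𝓝[<] (sInf S)) (𝓝 (g (sInf S)))) ?_
  filter_upwards [Ico_mem_nhdsLT hlt] with s hs using (hpos s hs).le

lemma eventually_forall_pos {F : ℝ → ℝ → ℝ} (hF : Continuous (Function.uncurry F)) {h₀ N : ℝ}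
    (h : ∀ t ∈ Set.Icc 0 N, 0 < F h₀ t) : ∀ᶠ k in 𝓝 h₀, ∀ t ∈ Set.Icc 0 N, 0 < F k t := by
  refine isCompact_Icc.eventually_forall_of_forall_eventually fun t ht => ?_
  exact hF.continuousAt.eventually_const_lt (h t ht)

/-- A family of functions of time, depending continuously on a parameter, such that the first zero
exists at the left end `a` of the parameter interval but not at the right end `b`, and such that
first zeros are sign changes: the first zero is continuous on a maximal interval `[a, c)` and tends
to infinity at `c`. -/
lemma exists_exit_time {F : ℝ → ℝ → ℝ} (hF : Continuous (Function.uncurry F)) {a b : ℝ}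
    (hab : a ≤ b) (h0 : ∀ h ∈ Set.Icc a b, 0 < F h 0) (ha : ∃ t, 0 ≤ t ∧ F a t ≤ 0)
    (hb : ∀ t, 0 ≤ t → 0 < F b t)
    (htr : ∀ h ∈ Set.Icc a b, ∀ T, 0 < T → F h T = 0 → (∀ t ∈ Set.Ico 0 T, 0 < F h t) →
      ∀ r > 0, ∃ s ∈ Set.Ioo T (T + r), F h s < 0) :
    ∃ c ∈ Set.Ioc a b, ∃ τ : ℝ → ℝ, ContinuousOn τ (Set.Ico a c) ∧
      Tendsto τ (𝓝[<] c) atTop ∧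
      ∀ h ∈ Set.Ico a c, 0 < τ h ∧ F h (τ h) = 0 ∧ ∀ t ∈ Set.Ico 0 (τ h), 0 < F h t := by
  have hFh : ∀ h, Continuous (F h) := fun h => by
    exact hF.comp (Continuous.prodMk_right h)
  have hFt : ∀ t, Continuous fun h => F h t := fun t => by
    exact hF.comp (Continuous.prodMk_left t)
  set B : Set ℝ := {h | h ∈ Set.Icc a b ∧ ∀ t, 0 ≤ t → 0 < F h t} with hB
  have hBn : B.Nonempty := ⟨b, ⟨hab, le_rfl⟩, hb⟩
  have hBb : BddBelow B := ⟨a, fun h hh => hh.1.1⟩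
  have hfirst : ∀ h ∈ Set.Icc a b, h ∉ B →
      ∃ T, 0 < T ∧ F h T = 0 ∧ ∀ t ∈ Set.Ico 0 T, 0 < F h t := by
    intro h hh hhB
    have : ∃ t, 0 ≤ t ∧ F h t ≤ 0 := by
      by_contra! hcon
      exact hhB ⟨hh, hcon⟩
    obtain ⟨t, ht, hle⟩ := this
    obtain ⟨T, hT, hz, hp⟩ := exists_first_zero (hFh h) ht (h0 h hh) hle
    exact ⟨T, hT.1, hz, hp⟩
  have hopen : ∀ h ∈ Set.Icc a b, h ∉ B → ∀ᶠ k in 𝓝 h, k ∉ B := by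
    intro h hh hhB
    obtain ⟨T, hT, hz, hp⟩ := hfirst h hh hhB
    obtain ⟨s, hs, hneg⟩ := htr h hh T hT hz hp 1 one_pos
    filter_upwards [(hFt s).continuousAt.eventually_lt_const hneg] with k hk hkB
    exact absurd (hkB.2 s (by linarith [hs.1])) (not_lt.2 hk.le)
  set c := sInf B with hc
  have hac : a ≤ c := le_csInf hBn fun h hh => hh.1.1
  have hcb : c ≤ b := csInf_le hBb ⟨⟨hab, le_rfl⟩, hb⟩
  have hcB : c ∈ B := by
    by_contra hcon
    have hcl : c ∈ closure B := csInf_mem_closure hBn hBb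
    rw [mem_closure_iff_frequently] at hcl
    exact hcl (hopen c ⟨hac, hcb⟩ hcon)
  have haB : a ∉ B := fun h => by
    obtain ⟨t, ht, hle⟩ := ha
    exact absurd (h.2 t ht) (not_lt.2 hle)
  have hac' : a < c := lt_of_le_of_ne hac fun h => haB (h ▸ hcB)
  have hnB : ∀ h ∈ Set.Ico a c, h ∉ B := fun h hh hhB =>
    absurd (csInf_le hBb hhB) (not_le.2 hh.2)
  have hI : ∀ h ∈ Set.Ico a c, h ∈ Set.Icc a b := fun h hh => ⟨hh.1, hh.2.le.trans hcb⟩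
  have hτex : ∀ h, ∃ T, h ∈ Set.Ico a c → 0 < T ∧ F h T = 0 ∧ ∀ t ∈ Set.Ico 0 T, 0 < F h t := by
    intro h
    by_cases hh : h ∈ Set.Ico a c
    · obtain ⟨T, hT⟩ := hfirst h (hI h hh) (hnB h hh)
      exact ⟨T, fun _ => hT⟩
    · exact ⟨0, fun h' => absurd h' hh⟩
  choose τ hτ using hτex
  have hlow : ∀ h ∈ Set.Ico a c, ∀ N, (∀ t ∈ Set.Icc 0 N, 0 < F h t) → N < τ h := by
    intro h hh N hN
    by_contra! hcon
    have := hN (τ h) ⟨(hτ h hh).1.le, hcon⟩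
    rw [(hτ h hh).2.1] at this
    exact lt_irrefl _ this
  refine ⟨c, ⟨hac', hcb⟩, τ, ?_, ?_, fun h hh => hτ h hh⟩
  · intro h hh
    obtain ⟨hT, hz, hp⟩ := hτ h hh
    rw [ContinuousWithinAt, tendsto_order]
    constructor
    · intro N hN
      have := eventually_forall_pos hF (h₀ := h) (N := N)
        fun t ht => hp t ⟨ht.1, ht.2.trans_lt hN⟩
      filter_upwards [nhdsWithin_le_nhds this, self_mem_nhdsWithin] with k hk hkI
      exact hlow k hkI N hk
    · intro N hN
      obtain ⟨s, hs, hneg⟩ := htr h (hI h hh) _ hT hz hp (N - τ h) (by linarith)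
      filter_upwards [nhdsWithin_le_nhds ((hFt s).continuousAt.eventually_lt_const hneg),
        self_mem_nhdsWithin] with k hk hkI
      have : τ k ≤ s := by
        by_contra! hcon
        exact absurd ((hτ k hkI).2.2 s ⟨by linarith [hs.1], hcon⟩) (not_lt.2 hk.le)
      linarith [hs.2]
  · rw [tendsto_atTop]
    intro N
    have := eventually_forall_pos hF (h₀ := c) (N := N) fun t ht => hcB.2 t ht.1
    filter_upwards [nhdsWithin_le_nhds this, Ico_mem_nhdsLT hac'] with k hk hkI
    exact (hlow k hkI N hk).le

end Exit

lemma le_of_hasDerivAt_nonneg {f f' : ℝ → ℝ} {s t : ℝ} (hst : s ≤ t)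
    (h : ∀ r ∈ Set.Icc s t, HasDerivAt f (f' r) r) (h' : ∀ r ∈ Set.Icc s t, 0 ≤ f' r) :
    f s ≤ f t := by
  refine monotoneOn_of_deriv_nonneg (convex_Icc s t)
    (fun r hr => (h r hr).continuousAt.continuousWithinAt)
    (fun r hr => (h r (interior_subset hr)).differentiableAt.differentiableWithinAt)
    (fun r hr => ?_) ⟨le_rfl, hst⟩ ⟨hst, le_rfl⟩ hst
  rw [(h r (interior_subset hr)).deriv]
  exact h' r (interior_subset hr)

lemma abs_sub_le_of_hasDerivAt {f f' : ℝ → ℝ} {s t C : ℝ} (hst : s ≤ t)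
    (h : ∀ r ∈ Set.Icc s t, HasDerivAt f (f' r) r) (h' : ∀ r ∈ Set.Icc s t, |f' r| ≤ C) :
    |f t - f s| ≤ C * (t - s) := by
  have h1 := le_of_hasDerivAt_nonneg (f := fun r => C * r - f r) (f' := fun r => C - f' r) hst
    (fun r hr => (((hasDerivAt_id r).const_mul C).sub (h r hr)).congr_deriv (by ring))
    (fun r hr => by linarith [(abs_le.1 (h' r hr)).2])
  have h2 := le_of_hasDerivAt_nonneg (f := fun r => C * r + f r) (f' := fun r => C + f' r) hst
    (fun r hr => (((hasDerivAt_id r).const_mul C).add (h r hr)).congr_deriv (by ring))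
    (fun r hr => by linarith [(abs_le.1 (h' r hr)).1])
  rw [abs_le]
  constructor <;> linarith

lemma hasDerivAt_sqrt_sq_add_sq {x y : ℝ → ℝ} {x' y' t : ℝ} (hx : HasDerivAt x x' t)
    (hy : HasDerivAt y y' t) (h : 0 < √(x t ^ 2 + y t ^ 2)) :
    HasDerivAt (fun s => √(x s ^ 2 + y s ^ 2)) ((x t * x' + y t * y') / √(x t ^ 2 + y t ^ 2)) t := by
  have h0 : x t ^ 2 + y t ^ 2 ≠ 0 := (Real.sqrt_pos.1 h).ne'
  refine (((hx.pow 2).add (hy.pow 2)).sqrt h0).congr_deriv ?_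
  simp only [Pi.add_apply, Pi.pow_apply]
  push_cast
  field_simp

lemma rotating_drift_le {f g e e' : ℝ → ℝ} {t C : ℝ} (ht : 0 ≤ t)
    (hf : ∀ r ∈ Set.Icc 0 t, HasDerivAt f (g r + e r) r)
    (hg : ∀ r ∈ Set.Icc 0 t, HasDerivAt g (-f r + e' r) r)
    (he : ∀ r ∈ Set.Icc 0 t, |e r| ≤ C) (he' : ∀ r ∈ Set.Icc 0 t, |e' r| ≤ C) :
    |f t * cos t - g t * sin t - f 0| ≤ 2 * C * t ∧
      |f t * sin t + g t * cos t - g 0| ≤ 2 * C * t := by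
  have bound : ∀ u v c d : ℝ, |u| ≤ C → |v| ≤ C → |c| ≤ 1 → |d| ≤ 1 → |u * c + v * d| ≤ 2 * C := by
    intro u v c d hu hv hc hd
    have hC : 0 ≤ C := (abs_nonneg u).trans hu
    have h1 : |u * c| ≤ C * 1 := by rw [abs_mul]; gcongr
    have h2 : |v * d| ≤ C * 1 := by rw [abs_mul]; gcongr
    exact (abs_add_le _ _).trans (by linarith)
  have h1 := abs_sub_le_of_hasDerivAt (f := fun s => f s * cos s - g s * sin s) ht
    (fun r hr => (((hf r hr).mul (hasDerivAt_cos r)).sub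
      ((hg r hr).mul (hasDerivAt_sin r))).congr_deriv
      (show _ = e r * cos r + e' r * (-sin r) by ring))
    (fun r hr => bound _ _ _ _ (he r hr) (he' r hr)
      (abs_cos_le_one r) (by rw [abs_neg]; exact abs_sin_le_one r))
  have h2 := abs_sub_le_of_hasDerivAt (f := fun s => f s * sin s + g s * cos s) ht
    (fun r hr => (((hf r hr).mul (hasDerivAt_sin r)).add
      ((hg r hr).mul (hasDerivAt_cos r))).congr_deriv
      (show _ = e r * sin r + e' r * cos r by ring))
    (fun r hr => bound _ _ _ _ (he r hr) (he' r hr) (abs_sin_le_one r) (abs_cos_le_one r))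
  simpa using And.intro h1 h2

/-- An arc of a perturbed Kepler problem in a frame rotating with unit speed: position `(x, y)`,
inertial velocity `(a, b)`, perturbing force `(P, Q)`. The arc starts at a pericentre at distance
`δ` with Kepler energy `h`, and its energy stays close to `h`. -/
structure NearArc (κ h δ T : ℝ) (x y a b P Q : ℝ → ℝ) : Prop where
  κ_lower : 999999 / 1000000 ≤ κ
  κ_upper : κ ≤ 1
  h_le : |h| ≤ 1 / 40
  δ_pos : 0 < δ
  δ_le : δ ≤ 1 / 10 ^ 10
  T_nonneg : 0 ≤ T
  pos : ∀ t ∈ Set.Icc 0 T, 0 < √(x t ^ 2 + y t ^ 2)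
  dx : ∀ t ∈ Set.Icc 0 T, HasDerivAt x (a t + y t) t
  dy : ∀ t ∈ Set.Icc 0 T, HasDerivAt y (b t - x t) t
  da : ∀ t ∈ Set.Icc 0 T, HasDerivAt a (b t - κ * x t / √(x t ^ 2 + y t ^ 2) ^ 3 + P t) t
  db : ∀ t ∈ Set.Icc 0 T, HasDerivAt b (-a t - κ * y t / √(x t ^ 2 + y t ^ 2) ^ 3 + Q t) t
  P_le : ∀ t ∈ Set.Icc 0 T, |P t| ≤ 1 / 10 ^ 7
  Q_le : ∀ t ∈ Set.Icc 0 T, |Q t| ≤ 1 / 10 ^ 7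
  dist_le : ∀ t ∈ Set.Icc 0 T, √(x t ^ 2 + y t ^ 2) ≤ 41 / 10
  energy_le : ∀ t ∈ Set.Icc 0 T,
    |(a t ^ 2 + b t ^ 2) / 2 - κ / √(x t ^ 2 + y t ^ 2) - h| ≤ 1 / 100
  x_zero : x 0 = δ
  y_zero : y 0 = 0
  a_zero : a 0 = 0
  b_zero : b 0 = √(2 * (κ / δ + h))

namespace NearArc

variable {κ h δ T : ℝ} {x y a b P Q : ℝ → ℝ}

lemma mul_inv_bounds (H : NearArc κ h δ T x y a b P Q) {t : ℝ} (ht : t ∈ Set.Icc 0 T) :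
    |x t| ≤ √(x t ^ 2 + y t ^ 2) ∧ |y t| ≤ √(x t ^ 2 + y t ^ 2) ∧
    (a t ^ 2 + b t ^ 2) * √(x t ^ 2 + y t ^ 2) ^ 2 ≤ 10 := by
  refine ⟨Real.abs_le_sqrt (by nlinarith [sq_nonneg (y t)]),
    Real.abs_le_sqrt (by nlinarith [sq_nonneg (x t)]), ?_⟩
  have h1 := H.pos t ht
  have h2 := H.dist_le t ht
  have h3 := (abs_le.1 (H.energy_le t ht)).2
  have h4 := (abs_le.1 H.h_le).2
  set ρ := √(x t ^ 2 + y t ^ 2)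
  have h5 : a t ^ 2 + b t ^ 2 ≤ 7 / 100 + 2 * (κ / ρ) := by linarith
  have h6 : (a t ^ 2 + b t ^ 2) * ρ ^ 2 ≤ (7 / 100 + 2 * (κ / ρ)) * ρ ^ 2 := by gcongr
  have h7 : (7 / 100 + 2 * (κ / ρ)) * ρ ^ 2 = 7 / 100 * ρ ^ 2 + 2 * κ * ρ := by
    field_simp
  have h8 : κ * ρ ≤ 1 * ρ := by gcongr; exact H.κ_upper
  nlinarith

lemma speed_mul_le (H : NearArc κ h δ T x y a b P Q) {t : ℝ} (ht : t ∈ Set.Icc 0 T) :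
    |a t| * √(x t ^ 2 + y t ^ 2) ≤ 4 ∧ |b t| * √(x t ^ 2 + y t ^ 2) ≤ 4 := by
  obtain ⟨-, -, h3⟩ := H.mul_inv_bounds ht
  have h1 := H.pos t ht
  set ρ := √(x t ^ 2 + y t ^ 2)
  constructor <;> refine abs_le_of_sq_le_sq' ?_ (by norm_num) |>.2 <;> rw [mul_pow, sq_abs] <;>
    nlinarith [sq_nonneg (a t * ρ), sq_nonneg (b t * ρ)]

lemma hasDerivAt_w (H : NearArc κ h δ T x y a b P Q) {t : ℝ} (ht : t ∈ Set.Icc 0 T) :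
    HasDerivAt (fun t => x t * a t + y t * b t)
      (a t ^ 2 + b t ^ 2 - κ / √(x t ^ 2 + y t ^ 2) + (x t * P t + y t * Q t)) t := by
  have h1 := H.pos t ht
  have h2 : √(x t ^ 2 + y t ^ 2) ^ 2 = x t ^ 2 + y t ^ 2 := Real.sq_sqrt (by positivity)
  refine (((H.dx t ht).mul (H.da t ht)).add ((H.dy t ht).mul (H.db t ht))).congr_deriv ?_
  set ρ := √(x t ^ 2 + y t ^ 2)
  have : κ / ρ = κ * (x t ^ 2 + y t ^ 2) / ρ ^ 3 := by rw [← h2]; field_simp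
  rw [this]
  ring

lemma force_work_le (H : NearArc κ h δ T x y a b P Q) {t : ℝ} (ht : t ∈ Set.Icc 0 T) :
    |x t * P t + y t * Q t| ≤ 1 / 10 ^ 6 ∧ |x t * Q t - y t * P t| ≤ 1 / 10 ^ 6 := by
  obtain ⟨h1, h2, -⟩ := H.mul_inv_bounds ht
  have h3 := H.dist_le t ht
  have hP := H.P_le t ht
  have hQ := H.Q_le t ht
  have k1 : |x t * P t| ≤ 41 / 10 * (1 / 10 ^ 7) := by
    rw [abs_mul]; gcongr; linarith
  have k2 : |y t * Q t| ≤ 41 / 10 * (1 / 10 ^ 7) := by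
    rw [abs_mul]; gcongr; linarith
  have k3 : |x t * Q t| ≤ 41 / 10 * (1 / 10 ^ 7) := by
    rw [abs_mul]; gcongr; linarith
  have k4 : |y t * P t| ≤ 41 / 10 * (1 / 10 ^ 7) := by
    rw [abs_mul]; gcongr; linarith
  constructor
  · refine (abs_add_le _ _).trans ?_
    norm_num at *; linarith
  · refine (abs_sub _ _).trans ?_
    norm_num at *; linarith

lemma deriv_w_lower (H : NearArc κ h δ T x y a b P Q) {t : ℝ} (ht : t ∈ Set.Icc 0 T) :
    κ / √(x t ^ 2 + y t ^ 2) - 71 / 1000 ≤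
      a t ^ 2 + b t ^ 2 - κ / √(x t ^ 2 + y t ^ 2) + (x t * P t + y t * Q t) := by
  have h3 := (abs_le.1 (H.energy_le t ht)).1
  have h4 := (abs_le.1 H.h_le).1
  have h5 := (abs_le.1 (H.force_work_le ht).1).1
  norm_num at *
  linarith

lemma deriv_w_lower' (H : NearArc κ h δ T x y a b P Q) {t : ℝ} (ht : t ∈ Set.Icc 0 T) :
    1 / (2 * √(x t ^ 2 + y t ^ 2)) ≤
      a t ^ 2 + b t ^ 2 - κ / √(x t ^ 2 + y t ^ 2) + (x t * P t + y t * Q t) := by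
  refine le_trans ?_ (H.deriv_w_lower ht)
  have h1 := H.pos t ht
  have h2 := H.dist_le t ht
  have h3 := H.κ_lower
  rw [le_sub_iff_add_le, div_add' _ _ _ (by positivity), div_le_div_iff₀ (by positivity) h1]
  nlinarith

lemma mono_Icc (H : NearArc κ h δ T x y a b P Q) {t : ℝ} (ht : t ∈ Set.Icc 0 T) :
    NearArc κ h δ t x y a b P Q := by
  have hs : ∀ s ∈ Set.Icc 0 t, s ∈ Set.Icc 0 T := fun s hs => ⟨hs.1, hs.2.trans ht.2⟩
  exact ⟨H.κ_lower, H.κ_upper, H.h_le, H.δ_pos, H.δ_le, ht.1, fun s h => H.pos s (hs s h),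
    fun s h => H.dx s (hs s h), fun s h => H.dy s (hs s h), fun s h => H.da s (hs s h),
    fun s h => H.db s (hs s h), fun s h => H.P_le s (hs s h), fun s h => H.Q_le s (hs s h),
    fun s h => H.dist_le s (hs s h), fun s h => H.energy_le s (hs s h), H.x_zero, H.y_zero,
    H.a_zero, H.b_zero⟩

lemma le_w (H : NearArc κ h δ T x y a b P Q) {t : ℝ} (ht : t ∈ Set.Icc 0 T) :
    t / 9 ≤ x t * a t + y t * b t := by
  have H' := H.mono_Icc ht
  have := le_of_hasDerivAt_nonneg (f := fun s => (x s * a s + y s * b s) - s / 9) ht.1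
    (fun r hr => (H'.hasDerivAt_w hr).sub ((hasDerivAt_id r).div_const 9))
    (fun r hr => by
      have h1 := H'.deriv_w_lower' hr
      have h2 := H'.pos r hr
      have h3 := H'.dist_le r hr
      have : (1 : ℝ) / 9 ≤ 1 / (2 * √(x r ^ 2 + y r ^ 2)) := by
        rw [div_le_div_iff₀ (by norm_num) (by positivity)]
        linarith
      simp only [sub_nonneg]
      linarith)
  simp only [H.y_zero, H.a_zero] at this
  linarith

lemma w_le (H : NearArc κ h δ T x y a b P Q) {t : ℝ} (ht : t ∈ Set.Icc 0 T) :
    x t * a t + y t * b t ≤ 4 := by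
  obtain ⟨-, -, h3⟩ := H.mul_inv_bounds ht
  have h2 : √(x t ^ 2 + y t ^ 2) ^ 2 = x t ^ 2 + y t ^ 2 := Real.sq_sqrt (by positivity)
  rw [h2] at h3
  nlinarith [sq_nonneg (x t * b t - y t * a t)]

lemma time_le (H : NearArc κ h δ T x y a b P Q) : T ≤ 36 := by
  have ht : T ∈ Set.Icc 0 T := ⟨H.T_nonneg, le_rfl⟩
  linarith [H.le_w ht, H.w_le ht]

lemma hasDerivAt_dist (H : NearArc κ h δ T x y a b P Q) {t : ℝ} (ht : t ∈ Set.Icc 0 T) :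
    HasDerivAt (fun t => √(x t ^ 2 + y t ^ 2))
      ((x t * a t + y t * b t) / √(x t ^ 2 + y t ^ 2)) t := by
  exact (hasDerivAt_sqrt_sq_add_sq (H.dx t ht) (H.dy t ht) (H.pos t ht)).congr_deriv (by ring)

lemma dist_mono (H : NearArc κ h δ T x y a b P Q) {s t : ℝ} (hs : 0 ≤ s) (hst : s ≤ t)
    (ht : t ≤ T) : √(x s ^ 2 + y s ^ 2) ≤ √(x t ^ 2 + y t ^ 2) := by
  have hI : ∀ r ∈ Set.Icc s t, r ∈ Set.Icc 0 T := fun r hr => ⟨hs.trans hr.1, hr.2.trans ht⟩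
  refine le_of_hasDerivAt_nonneg (f := fun t => √(x t ^ 2 + y t ^ 2)) hst
    (fun r hr => H.hasDerivAt_dist (hI r hr)) fun r hr => ?_
  have := H.le_w (hI r hr)
  have := (hI r hr).1
  exact div_nonneg (by linarith) (H.pos r (hI r hr)).le

lemma le_dist (H : NearArc κ h δ T x y a b P Q) {t : ℝ} (ht : t ∈ Set.Icc 0 T) :
    δ ≤ √(x t ^ 2 + y t ^ 2) := by
  have := H.dist_mono le_rfl ht.1 ht.2
  rw [H.x_zero, H.y_zero] at this
  simpa [Real.sqrt_sq H.δ_pos.le] using this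

lemma sq_b_zero (H : NearArc κ h δ T x y a b P Q) : b 0 ^ 2 = 2 * (κ / δ + h) := by
  rw [H.b_zero, Real.sq_sqrt]
  have h1 := H.κ_lower
  have h2 := H.δ_pos
  have h3 := H.δ_le
  have h4 := (abs_le.1 H.h_le).1
  have : 1 / 2 ≤ κ / δ := by
    rw [le_div_iff₀ h2]; norm_num at *; linarith
  linarith

lemma energy_close (H : NearArc κ h δ T x y a b P Q) {t : ℝ} (ht : t ∈ Set.Icc 0 T) :
    |(a t ^ 2 + b t ^ 2) / 2 - κ / √(x t ^ 2 + y t ^ 2) - h| ≤ 1 / 10 ^ 5 := by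
  have H' := H.mono_Icc ht
  have hE : ∀ r ∈ Set.Icc 0 t, HasDerivAt
      (fun r => (a r ^ 2 + b r ^ 2) / 2 - κ / √(x r ^ 2 + y r ^ 2))
      (a r * P r + b r * Q r) r := by
    intro r hr
    have h1 := H'.pos r hr
    refine (((((H'.da r hr).pow 2).add ((H'.db r hr).pow 2)).div_const 2).sub
      ((hasDerivAt_const r κ).div (H'.hasDerivAt_dist hr) h1.ne')).congr_deriv ?_
    set ρ := √(x r ^ 2 + y r ^ 2)
    push_cast
    field_simp
    ring
  have hE' : ∀ r ∈ Set.Icc 0 t, |a r * P r + b r * Q r| ≤ 2 / 10 ^ 6 *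
      (a r ^ 2 + b r ^ 2 - κ / √(x r ^ 2 + y r ^ 2) + (x r * P r + y r * Q r)) := by
    intro r hr
    have h1 := H'.pos r hr
    have h2 := H'.deriv_w_lower' hr
    obtain ⟨h3, h4⟩ := H'.speed_mul_le hr
    have hP := H'.P_le r hr
    have hQ := H'.Q_le r hr
    refine (?_ : _ ≤ 2 / 10 ^ 6 * (1 / (2 * √(x r ^ 2 + y r ^ 2)))).trans (by gcongr)
    set ρ := √(x r ^ 2 + y r ^ 2)
    have k1 : |a r * P r| ≤ 4 / ρ * (1 / 10 ^ 7) := by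
      rw [abs_mul]; gcongr; rwa [le_div_iff₀ h1]
    have k2 : |b r * Q r| ≤ 4 / ρ * (1 / 10 ^ 7) := by
      rw [abs_mul]; gcongr; rwa [le_div_iff₀ h1]
    have e : 2 / 10 ^ 6 * (1 / (2 * ρ)) = 10 / ρ * (1 / 10 ^ 7) := by field_simp
    have e2 : 4 / ρ * (1 / 10 ^ 7) + 4 / ρ * (1 / 10 ^ 7) = 8 / ρ * (1 / 10 ^ 7) := by ring
    have e3 : 8 / ρ * (1 / 10 ^ 7) ≤ 10 / ρ * ((1 : ℝ) / 10 ^ 7) := by gcongr; norm_num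
    rw [e]
    exact (abs_add_le _ _).trans (by linarith)
  have m1 := le_of_hasDerivAt_nonneg ht.1
    (fun r hr => ((H'.hasDerivAt_w hr).const_mul (2 / 10 ^ 6)).sub (hE r hr))
    (fun r hr => by have := (abs_le.1 (hE' r hr)).2; linarith)
  have m2 := le_of_hasDerivAt_nonneg ht.1
    (fun r hr => ((H'.hasDerivAt_w hr).const_mul (2 / 10 ^ 6)).add (hE r hr))
    (fun r hr => by have := (abs_le.1 (hE' r hr)).1; linarith)
  have hw := H.w_le ht
  have h0 : (a 0 ^ 2 + b 0 ^ 2) / 2 - κ / √(x 0 ^ 2 + y 0 ^ 2) = h := by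
    rw [H.sq_b_zero, H.a_zero, H.x_zero, H.y_zero]
    simp only [ne_eq, OfNat.ofNat_ne_zero, not_false_eq_true, zero_pow, add_zero,
      Real.sqrt_sq H.δ_pos.le]
    ring
  have hw0 : x 0 * a 0 + y 0 * b 0 = 0 := by rw [H.a_zero, H.y_zero]; ring
  simp only [Pi.sub_apply, Pi.add_apply, h0, hw0] at m1 m2
  rw [abs_le]
  norm_num at *
  constructor <;> linarith

lemma angular_le (H : NearArc κ h δ T x y a b P Q) {t : ℝ} (ht : t ∈ Set.Icc 0 T) :
    |x t * b t - y t * a t| ≤ 1 / 10 ^ 4 := by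
  have H' := H.mono_Icc ht
  have hL := abs_sub_le_of_hasDerivAt (f := fun t => x t * b t - y t * a t)
    (f' := fun t => x t * Q t - y t * P t) ht.1
    (fun r hr => by
      refine (((H'.dx r hr).mul (H'.db r hr)).sub ((H'.dy r hr).mul (H'.da r hr))).congr_deriv ?_
      ring) (fun r hr => (H'.force_work_le hr).2)
  have h0 : |x 0 * b 0 - y 0 * a 0| ≤ 2 / 10 ^ 5 := by
    refine abs_le_of_sq_le_sq ?_ (by norm_num)
    rw [H.y_zero, zero_mul, sub_zero, mul_pow, H.sq_b_zero, H.x_zero]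
    have h1 := H.κ_upper
    have h2 := H.δ_pos
    have h3 := H.δ_le
    have h4 := (abs_le.1 H.h_le).2
    have e : δ ^ 2 * (2 * (κ / δ + h)) = 2 * δ * κ + 2 * h * δ ^ 2 := by field_simp
    rw [e]
    have h5 : 2 * δ * κ ≤ 2 * δ * 1 := by gcongr
    have h6 : 2 * h * δ ^ 2 ≤ 2 * 1 * δ ^ 2 := by gcongr; linarith
    norm_num at *
    nlinarith
  have := H'.time_le
  have h3 := abs_sub_abs_le_abs_sub (x t * b t - y t * a t) (x 0 * b 0 - y 0 * a 0)
  norm_num at *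
  linarith

lemma time_le_of_dist_le (H : NearArc κ h δ T x y a b P Q) {t : ℝ} (ht : t ∈ Set.Icc 0 T)
    (hd : √(x t ^ 2 + y t ^ 2) ≤ 6 / 5) : t ≤ 3 / 2 := by
  have H' := H.mono_Icc ht
  have hw : ∀ s ∈ Set.Icc 0 t, 18 / 25 * s ≤ x s * a s + y s * b s := by
    intro s hs
    have H'' := H'.mono_Icc hs
    have := le_of_hasDerivAt_nonneg (f := fun s => (x s * a s + y s * b s) - 18 / 25 * s) hs.1
      (fun r hr => (H''.hasDerivAt_w hr).sub ((hasDerivAt_id r).const_mul (18 / 25)))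
      (fun r hr => by
        have h1 := H''.deriv_w_lower hr
        have h2 := H''.pos r hr
        have h3 := (H'.dist_mono hr.1 (hr.2.trans hs.2) le_rfl).trans hd
        have h4 : 4 / 5 ≤ κ / √(x r ^ 2 + y r ^ 2) := by
          rw [le_div_iff₀ h2]
          linarith [H.κ_lower]
        norm_num at *
        linarith)
    simp only [H.y_zero, H.a_zero] at this
    linarith
  have := le_of_hasDerivAt_nonneg (f := fun s => (x s ^ 2 + y s ^ 2) - 18 / 25 * s ^ 2)
    (f' := fun s => 2 * (x s * a s + y s * b s) - 36 / 25 * s) ht.1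
    (fun r hr => (((H'.dx r hr).pow 2).add ((H'.dy r hr).pow 2)).sub
      (((hasDerivAt_id r).pow 2).const_mul (18 / 25)) |>.congr_deriv (by
        simp only [id]; push_cast; ring))
    (fun r hr => by linarith [hw r hr])
  have h2 : √(x t ^ 2 + y t ^ 2) ^ 2 = x t ^ 2 + y t ^ 2 := Real.sq_sqrt (by positivity)
  have h3 := Real.sqrt_nonneg (x t ^ 2 + y t ^ 2)
  nlinarith [sq_nonneg (x 0), sq_nonneg (y 0)]

lemma hasDerivAt_lenz_fst (H : NearArc κ h δ T x y a b P Q) {t : ℝ} (ht : t ∈ Set.Icc 0 T) :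
    HasDerivAt (fun t => (x t * b t - y t * a t) * b t - κ * x t / √(x t ^ 2 + y t ^ 2))
      ((-(x t * b t - y t * a t) * a t - κ * y t / √(x t ^ 2 + y t ^ 2)) +
        ((x t * Q t - y t * P t) * b t + (x t * b t - y t * a t) * Q t)) t := by
  have h1 := H.pos t ht
  have h2 : √(x t ^ 2 + y t ^ 2) ^ 2 = x t ^ 2 + y t ^ 2 := Real.sq_sqrt (by positivity)
  refine (((((H.dx t ht).mul (H.db t ht)).sub ((H.dy t ht).mul (H.da t ht))).mul (H.db t ht)).sub
    (((H.dx t ht).const_mul κ).div (H.hasDerivAt_dist ht) h1.ne')).congr_deriv ?_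
  simp only [Pi.sub_apply, Pi.mul_apply]
  set ρ := √(x t ^ 2 + y t ^ 2)
  field_simp
  linear_combination (-κ * a t) * h2

lemma hasDerivAt_lenz_snd (H : NearArc κ h δ T x y a b P Q) {t : ℝ} (ht : t ∈ Set.Icc 0 T) :
    HasDerivAt (fun t => -(x t * b t - y t * a t) * a t - κ * y t / √(x t ^ 2 + y t ^ 2))
      (-((x t * b t - y t * a t) * b t - κ * x t / √(x t ^ 2 + y t ^ 2)) +
        (-(x t * Q t - y t * P t) * a t - (x t * b t - y t * a t) * P t)) t := by
  have h1 := H.pos t ht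
  have h2 : √(x t ^ 2 + y t ^ 2) ^ 2 = x t ^ 2 + y t ^ 2 := Real.sq_sqrt (by positivity)
  refine (((((H.dx t ht).mul (H.db t ht)).sub ((H.dy t ht).mul (H.da t ht))).neg.mul
    (H.da t ht)).sub (((H.dy t ht).const_mul κ).div (H.hasDerivAt_dist ht) h1.ne')).congr_deriv ?_
  simp only [Pi.sub_apply, Pi.mul_apply, Pi.neg_apply]
  set ρ := √(x t ^ 2 + y t ^ 2)
  field_simp
  linear_combination (-κ * b t) * h2

lemma lenz_error_le (H : NearArc κ h δ T x y a b P Q) {t : ℝ} (ht : t ∈ Set.Icc 0 T) :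
    |(x t * Q t - y t * P t) * b t + (x t * b t - y t * a t) * Q t| ≤ 1 / 10 ^ 6 ∧
    |-(x t * Q t - y t * P t) * a t - (x t * b t - y t * a t) * P t| ≤ 1 / 10 ^ 6 := by
  obtain ⟨hx, hy, -⟩ := H.mul_inv_bounds ht
  obtain ⟨ha, hb⟩ := H.speed_mul_le ht
  have hL := H.angular_le ht
  have hP := H.P_le t ht
  have hQ := H.Q_le t ht
  set ρ := √(x t ^ 2 + y t ^ 2)
  have key : ∀ u : ℝ, |u| * ρ ≤ 4 → |(x t * Q t - y t * P t) * u| ≤ 8 * (1 / 10 ^ 7) := by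
    intro u hu
    have e1 : |x t * u * Q t| ≤ 4 * (1 / 10 ^ 7) := by
      rw [abs_mul, abs_mul]
      gcongr
      exact (mul_le_mul_of_nonneg_right hx (abs_nonneg u)).trans (by linarith)
    have e2 : |y t * u * P t| ≤ 4 * (1 / 10 ^ 7) := by
      rw [abs_mul, abs_mul]
      gcongr
      exact (mul_le_mul_of_nonneg_right hy (abs_nonneg u)).trans (by linarith)
    have e3 : (x t * Q t - y t * P t) * u = x t * u * Q t - y t * u * P t := by ring
    rw [e3]
    exact (abs_sub _ _).trans (by linarith)
  have k1 := key _ hb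
  have k2 := key _ ha
  have k3 : |(x t * b t - y t * a t) * Q t| ≤ 1 / 10 ^ 4 * (1 / 10 ^ 7) := by
    rw [abs_mul]; gcongr
  have k4 : |(x t * b t - y t * a t) * P t| ≤ 1 / 10 ^ 4 * (1 / 10 ^ 7) := by
    rw [abs_mul]; gcongr
  constructor
  · refine (abs_add_le _ _).trans ?_
    norm_num at *; linarith
  · refine (abs_sub _ _).trans ?_
    rw [neg_mul, abs_neg]
    norm_num at *; linarith

lemma lenz_close (H : NearArc κ h δ T x y a b P Q) {t : ℝ} (ht : t ∈ Set.Icc 0 T)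
    (ht2 : t ≤ 3 / 2) : ∃ B C : ℝ, |B - 1| ≤ 1 / 100 ∧ |C| ≤ 1 / 100 ∧
      (x t * b t - y t * a t) ^ 2 - κ * √(x t ^ 2 + y t ^ 2) =
      B * (x t * cos t - y t * sin t) + C * (x t * sin t + y t * cos t) := by
  have H' := H.mono_Icc ht
  have hρ0 := H.pos t ht
  have hρ : √(x t ^ 2 + y t ^ 2) ^ 2 = x t ^ 2 + y t ^ 2 := Real.sq_sqrt (by positivity)
  obtain ⟨A, hA⟩ : ∃ A : ℝ → ℝ, A = fun t => (x t * b t - y t * a t) * b t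
    - κ * x t / √(x t ^ 2 + y t ^ 2) := ⟨_, rfl⟩
  obtain ⟨A', hA'⟩ : ∃ A' : ℝ → ℝ, A' = fun t => -(x t * b t - y t * a t) * a t
    - κ * y t / √(x t ^ 2 + y t ^ 2) := ⟨_, rfl⟩
  have hdA := fun r hr => hA ▸ H'.hasDerivAt_lenz_fst (t := r) hr
  have hdA' := fun r hr => hA' ▸ H'.hasDerivAt_lenz_snd (t := r) hr
  obtain ⟨hB, hC⟩ := rotating_drift_le ht.1
    (fun r hr => (hdA r hr).congr_deriv (show _ = A' r + _ by rw [hA']))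
    (fun r hr => (hdA' r hr).congr_deriv (show _ = -A r + _ by rw [hA]))
    (fun r hr => (H'.lenz_error_le hr).1) (fun r hr => (H'.lenz_error_le hr).2)
  have hA0 : A 0 = κ + 2 * h * δ := by
    have h1 := H.sq_b_zero
    have h2 := H.δ_pos
    have e : A 0 = δ * b 0 ^ 2 - κ := by
      simp only [hA, H.x_zero, H.y_zero, zero_pow two_ne_zero, add_zero, Real.sqrt_sq h2.le]
      field_simp
      ring
    rw [e, h1]
    field_simp
    ring
  have hA'0 : A' 0 = 0 := by simp [hA', H.a_zero, H.y_zero]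
  rw [hA0] at hB
  rw [hA'0, sub_zero] at hC
  have hdot : A t * x t + A' t * y t =
      (x t * b t - y t * a t) ^ 2 - κ * √(x t ^ 2 + y t ^ 2) := by
    simp only [hA, hA']
    set ρ := √(x t ^ 2 + y t ^ 2)
    field_simp
    linear_combination κ * hρ
  have hδ : |2 * h * δ| ≤ 1 / 10 ^ 6 := by
    rw [abs_mul, abs_mul, abs_of_pos H.δ_pos, abs_two]
    have := mul_le_mul (mul_le_mul_of_nonneg_left H.h_le zero_le_two) H.δ_le H.δ_pos.le
      (by norm_num)
    norm_num at this ⊢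
    linarith
  have hκ := H.κ_lower
  have hκ' := H.κ_upper
  refine ⟨A t * cos t - A' t * sin t, A t * sin t + A' t * cos t, ?_, ?_, hdot.symm.trans ?_⟩
  · rw [abs_le] at hB hδ ⊢
    norm_num at hB hδ ⊢
    constructor <;> linarith
  · norm_num at hC ⊢
    linarith
  · linear_combination (-(A t * x t + A' t * y t)) * sin_sq_add_cos_sq t

lemma le_dist_secondary (H : NearArc κ h δ T x y a b P Q) {t : ℝ} (ht : t ∈ Set.Icc 0 T) :
    1 / 5 ≤ √((x t - 1) ^ 2 + y t ^ 2) := by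
  by_contra! hd
  have hd' : (x t - 1) ^ 2 + y t ^ 2 < 1 / 25 := by
    rw [Real.sqrt_lt' (by norm_num)] at hd; linarith
  have hx1 : 4 / 5 ≤ x t := by nlinarith [sq_nonneg (y t)]
  have hx2 : x t ≤ 6 / 5 := by nlinarith [sq_nonneg (y t)]
  have hy : |y t| ≤ 1 / 5 := abs_le_of_sq_le_sq (by nlinarith [sq_nonneg (x t - 1)]) (by norm_num)
  have hρ1 : 4 / 5 ≤ √(x t ^ 2 + y t ^ 2) :=
    Real.le_sqrt_of_sq_le (by nlinarith [sq_nonneg (y t)])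
  have hρ2 : √(x t ^ 2 + y t ^ 2) ≤ 6 / 5 := by
    rw [Real.sqrt_le_left (by norm_num)]; nlinarith
  have ht2 := H.time_le_of_dist_le ht hρ2
  obtain ⟨B, C, hB, hC, hsplit⟩ := H.lenz_close ht ht2
  have hcos : 0 ≤ cos t := cos_nonneg_of_mem_Icc ⟨by linarith [pi_gt_three, ht.1],
    by linarith [pi_gt_three]⟩
  have hys : |y t * sin t| ≤ 1 / 5 * 1 := by
    rw [abs_mul]; gcongr; exact abs_sin_le_one t
  have hyc : |y t * cos t| ≤ 1 / 5 * 1 := by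
    rw [abs_mul]; gcongr; exact abs_cos_le_one t
  have hxs : |x t * sin t| ≤ 6 / 5 * 1 := by
    rw [abs_mul, abs_of_pos (by linarith : 0 < x t)]; gcongr
    exact abs_sin_le_one t
  have hCterm : |C * (x t * sin t + y t * cos t)| ≤ 1 / 100 * (7 / 5) := by
    rw [abs_mul]; gcongr
    exact (abs_add_le _ _).trans (by linarith)
  have hL := H.angular_le ht
  have hL2 : (x t * b t - y t * a t) ^ 2 ≤ (1 / 10 ^ 4) ^ 2 :=
    sq_le_sq' (abs_le.1 hL).1 (abs_le.1 hL).2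
  have hxc : 0 ≤ x t * cos t := mul_nonneg (by linarith) hcos
  have hκρ : 999999 / 1000000 * (4 / 5) ≤ κ * √(x t ^ 2 + y t ^ 2) := by
    exact mul_le_mul H.κ_lower hρ1 (by norm_num) (by linarith [H.κ_lower])
  have h1 := abs_le.1 hB
  have h2 := abs_le.1 hCterm
  have h3 := abs_le.1 hys
  have h4 : -(11 / 50) ≤ B * (x t * cos t - y t * sin t) := by nlinarith
  norm_num at hL2 hκρ h2
  linarith

end NearArc

lemma eventually_gt_of_hasDerivAt_pos {f : ℝ → ℝ} {f' t : ℝ} (h : HasDerivAt f f' t)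
    (hf' : 0 < f') : ∀ᶠ s in 𝓝[>] t, f t < f s := by
  have h1 := (hasDerivAt_iff_tendsto_slope.1 h).eventually (lt_mem_nhds hf')
  have h2 : 𝓝[>] t ≤ 𝓝[≠] t := nhdsWithin_mono _ fun s hs => ne_of_gt hs
  filter_upwards [h2 h1, self_mem_nhdsWithin] with s hs hst
  rw [Set.mem_Ioi] at hst
  rw [slope_def_field, lt_div_iff₀ (by linarith)] at hs
  linarith

/-- Data of a solution far from the primaries, in barycentric rotating coordinates: position
`(X, Y)`, inertial velocity `(α, β)`, force `(U, V)`, potential `Φ`; at time `t₁` the solution leaves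
the disc of radius `4` almost radially, with Kepler energy close to `h`. -/
structure FarArc (h t₁ : ℝ) (X Y α β U V Φ : ℝ → ℝ) : Prop where
  h_le : |h| ≤ 1 / 40
  dX : ∀ t, HasDerivAt X (α t + Y t) t
  dY : ∀ t, HasDerivAt Y (β t - X t) t
  dα : ∀ t, HasDerivAt α (β t + U t) t
  dβ : ∀ t, HasDerivAt β (-α t + V t) t
  dΦ : ∀ t, 4 ≤ √(X t ^ 2 + Y t ^ 2) →
    HasDerivAt Φ (-(U t * (α t + Y t) + V t * (β t - X t))) t
  radial_le : ∀ t, 4 ≤ √(X t ^ 2 + Y t ^ 2) →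
    |X t * U t + Y t * V t + 1 / √(X t ^ 2 + Y t ^ 2)| ≤ 1 / (1000 * √(X t ^ 2 + Y t ^ 2))
  potential_le : ∀ t, 4 ≤ √(X t ^ 2 + Y t ^ 2) →
    |Φ t + 1 / √(X t ^ 2 + Y t ^ 2)| ≤ 1 / (1000 * √(X t ^ 2 + Y t ^ 2))
  dist_start : √(X t₁ ^ 2 + Y t₁ ^ 2) = 4
  angular_start : |X t₁ * β t₁ - Y t₁ * α t₁| ≤ 1 / 1000
  radial_start : 0 < X t₁ * α t₁ + Y t₁ * β t₁
  energy_start : |((X t₁ * α t₁ + Y t₁ * β t₁) / √(X t₁ ^ 2 + Y t₁ ^ 2)) ^ 2 / 2 - 1 / 4 - h|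
    ≤ 1 / 1000

namespace FarArc

variable {h t₁ T : ℝ} {X Y α β U V Φ : ℝ → ℝ}

/-- The radial velocity is nonnegative and the angular momentum is moderate on `[t₁, T]`. -/
def Outgoing (t₁ T : ℝ) (X Y α β : ℝ → ℝ) : Prop :=
  t₁ ≤ T ∧ ∀ t ∈ Set.Icc t₁ T, 0 ≤ X t * α t + Y t * β t ∧ |X t * β t - Y t * α t| ≤ 1 / 2

lemma Outgoing.mono (G : Outgoing t₁ T X Y α β) {t : ℝ} (ht : t ∈ Set.Icc t₁ T) :
    Outgoing t₁ t X Y α β :=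
  ⟨ht.1, fun s hs => G.2 s ⟨hs.1, hs.2.trans ht.2⟩⟩

lemma hasDerivAt_sq_dist (H : FarArc h t₁ X Y α β U V Φ) (t : ℝ) :
    HasDerivAt (fun t => X t ^ 2 + Y t ^ 2) (2 * (X t * α t + Y t * β t)) t :=
  (((H.dX t).pow 2).add ((H.dY t).pow 2)).congr_deriv (by push_cast; ring)

lemma sqrt_mono (H : FarArc h t₁ X Y α β U V Φ) (G : Outgoing t₁ T X Y α β) {s : ℝ}
    (hs : s ∈ Set.Icc t₁ T) : √(X s ^ 2 + Y s ^ 2) ≤ √(X T ^ 2 + Y T ^ 2) := by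
  refine Real.sqrt_le_sqrt ?_
  exact le_of_hasDerivAt_nonneg (f := fun t => X t ^ 2 + Y t ^ 2) hs.2
    (fun r _ => H.hasDerivAt_sq_dist r)
    fun r hr => mul_nonneg zero_le_two (G.2 r ⟨hs.1.trans hr.1, hr.2⟩).1

lemma four_le_dist (H : FarArc h t₁ X Y α β U V Φ) (G : Outgoing t₁ T X Y α β) :
    4 ≤ √(X T ^ 2 + Y T ^ 2) := by
  rw [← H.dist_start]
  exact H.sqrt_mono G ⟨le_rfl, G.1⟩

lemma hasDerivAt_dist (H : FarArc h t₁ X Y α β U V Φ) {t : ℝ} (ht : 4 ≤ √(X t ^ 2 + Y t ^ 2)) :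
    HasDerivAt (fun t => √(X t ^ 2 + Y t ^ 2))
      ((X t * α t + Y t * β t) / √(X t ^ 2 + Y t ^ 2)) t :=
  (hasDerivAt_sqrt_sq_add_sq (H.dX t) (H.dY t) (by linarith)).congr_deriv (by ring)

lemma hasDerivAt_radial (H : FarArc h t₁ X Y α β U V Φ) (t : ℝ) :
    HasDerivAt (fun t => X t * α t + Y t * β t)
      (α t ^ 2 + β t ^ 2 + (X t * U t + Y t * V t)) t :=
  (((H.dX t).mul (H.dα t)).add ((H.dY t).mul (H.dβ t))).congr_deriv (by ring)

lemma hasDerivAt_radialSpeed (H : FarArc h t₁ X Y α β U V Φ) {t : ℝ}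
    (ht : 4 ≤ √(X t ^ 2 + Y t ^ 2)) :
    HasDerivAt (fun t => (X t * α t + Y t * β t) / √(X t ^ 2 + Y t ^ 2))
      ((X t * β t - Y t * α t) ^ 2 / √(X t ^ 2 + Y t ^ 2) ^ 3 +
        (X t * U t + Y t * V t) / √(X t ^ 2 + Y t ^ 2)) t := by
  have h2 : √(X t ^ 2 + Y t ^ 2) ^ 2 = X t ^ 2 + Y t ^ 2 := Real.sq_sqrt (by positivity)
  refine ((H.hasDerivAt_radial t).div (H.hasDerivAt_dist ht) (by linarith)).congr_deriv ?_
  set r := √(X t ^ 2 + Y t ^ 2)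
  have hr : 0 < r := by linarith
  field_simp
  linear_combination (α t ^ 2 + β t ^ 2) * h2

lemma radial_bounds (H : FarArc h t₁ X Y α β U V Φ) {t : ℝ} (ht : 4 ≤ √(X t ^ 2 + Y t ^ 2)) :
    -(1001 / 1000) / √(X t ^ 2 + Y t ^ 2) ≤ X t * U t + Y t * V t ∧
      X t * U t + Y t * V t ≤ -(999 / 1000) / √(X t ^ 2 + Y t ^ 2) := by
  have h1 := abs_le.1 (H.radial_le t ht)
  set r := √(X t ^ 2 + Y t ^ 2)
  have hr : 0 < r := by linarith
  have e1 : -(1001 / 1000) / r = -(1 / (1000 * r)) - 1 / r := by field_simp; norm_num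
  have e2 : -(999 / 1000) / r = 1 / (1000 * r) - 1 / r := by field_simp; norm_num
  rw [e1, e2]
  constructor <;> linarith

lemma radialSpeed_deriv_le (H : FarArc h t₁ X Y α β U V Φ) {t : ℝ}
    (ht : 4 ≤ √(X t ^ 2 + Y t ^ 2)) (hl : |X t * β t - Y t * α t| ≤ 1 / 2) :
    (X t * β t - Y t * α t) ^ 2 / √(X t ^ 2 + Y t ^ 2) ^ 3 +
        (X t * U t + Y t * V t) / √(X t ^ 2 + Y t ^ 2) ≤ -(9 / 10) / √(X t ^ 2 + Y t ^ 2) ^ 2 := by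
  have h1 := (H.radial_bounds ht).2
  set r := √(X t ^ 2 + Y t ^ 2)
  have hr : 0 < r := by linarith
  have h3 : (X t * β t - Y t * α t) ^ 2 ≤ (1 / 2) ^ 2 := sq_le_sq' (abs_le.1 hl).1 (abs_le.1 hl).2
  have h4 : (X t * β t - Y t * α t) ^ 2 / r ^ 3 ≤ (1 / 16) / r ^ 2 := by
    rw [div_le_div_iff₀ (by positivity) (by positivity)]
    nlinarith [sq_nonneg r, mul_le_mul_of_nonneg_right ht (sq_nonneg r)]
  have h5 : (X t * U t + Y t * V t) / r ≤ -(999 / 1000) / r / r := by gcongr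
  have h6 : -(999 / 1000) / r / r = -(9 / 10) / r ^ 2 - (99 / 1000) / r ^ 2 := by field_simp; norm_num
  have h7 : (1 : ℝ) / 16 / r ^ 2 ≤ (99 / 1000) / r ^ 2 :=
    div_le_div_of_nonneg_right (by norm_num) (by positivity)
  linarith

lemma radialSpeed_anti (H : FarArc h t₁ X Y α β U V Φ) (G : Outgoing t₁ T X Y α β) {s : ℝ}
    (hs : s ∈ Set.Icc t₁ T) :
    (X T * α T + Y T * β T) / √(X T ^ 2 + Y T ^ 2) + 9 / 10 / √(X T ^ 2 + Y T ^ 2) ^ 2 * (T - s) ≤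
      (X s * α s + Y s * β s) / √(X s ^ 2 + Y s ^ 2) := by
  have := le_of_hasDerivAt_nonneg (s := s) (t := T) (f := fun t =>
      -((X t * α t + Y t * β t) / √(X t ^ 2 + Y t ^ 2)) - 9 / 10 / √(X T ^ 2 + Y T ^ 2) ^ 2 * t) hs.2
    (fun r hr => (H.hasDerivAt_radialSpeed (H.four_le_dist (G.mono ⟨hs.1.trans hr.1, hr.2⟩))).neg.sub
      ((hasDerivAt_id r).const_mul (9 / 10 / √(X T ^ 2 + Y T ^ 2) ^ 2)))
    (fun r hr => by
      have hr' : r ∈ Set.Icc t₁ T := ⟨hs.1.trans hr.1, hr.2⟩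
      have h1 := H.four_le_dist (G.mono hr')
      have h2 := H.radialSpeed_deriv_le h1 (G.2 r hr').2
      have h3 := H.sqrt_mono G hr'
      have h4 : 9 / 10 / √(X T ^ 2 + Y T ^ 2) ^ 2 ≤ 9 / 10 / √(X r ^ 2 + Y r ^ 2) ^ 2 := by gcongr
      rw [neg_div] at h2
      linarith)
  linarith

lemma sq_radialSpeed_le (H : FarArc h t₁ X Y α β U V Φ) (G : Outgoing t₁ T X Y α β) :
    ((X T * α T + Y T * β T) / √(X T ^ 2 + Y T ^ 2)) ^ 2 ≤
      ((X t₁ * α t₁ + Y t₁ * β t₁) / √(X t₁ ^ 2 + Y t₁ ^ 2)) ^ 2 := by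
  have h1 := H.radialSpeed_anti G ⟨le_rfl, G.1⟩
  have h2 : 0 ≤ 9 / 10 / √(X T ^ 2 + Y T ^ 2) ^ 2 * (T - t₁) :=
    mul_nonneg (by positivity) (by linarith [G.1])
  have h3 := (G.2 T ⟨G.1, le_rfl⟩).1
  exact pow_le_pow_left₀ (by positivity) (by linarith) 2

lemma jacobi_eq (H : FarArc h t₁ X Y α β U V Φ) (G : Outgoing t₁ T X Y α β) :
    (α T ^ 2 + β T ^ 2) / 2 - (X T * β T - Y T * α T) + Φ T =
      (α t₁ ^ 2 + β t₁ ^ 2) / 2 - (X t₁ * β t₁ - Y t₁ * α t₁) + Φ t₁ := by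
  have := abs_sub_le_of_hasDerivAt (C := 0) (f := fun t =>
      (α t ^ 2 + β t ^ 2) / 2 - (X t * β t - Y t * α t) + Φ t) (f' := fun _ => 0) G.1
    (fun r hr => ((((((H.dα r).pow 2).add ((H.dβ r).pow 2)).div_const 2).sub
      (((H.dX r).mul (H.dβ r)).sub ((H.dY r).mul (H.dα r)))).add
      (H.dΦ r (H.four_le_dist (G.mono hr)))).congr_deriv (by push_cast; ring))
    (fun r hr => by simp)
  rw [zero_mul, abs_nonpos_iff, sub_eq_zero] at this
  exact this

lemma sq_speed_eq {t : ℝ} (ht : 4 ≤ √(X t ^ 2 + Y t ^ 2)) :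
    α t ^ 2 + β t ^ 2 = ((X t * α t + Y t * β t) / √(X t ^ 2 + Y t ^ 2)) ^ 2 +
      (X t * β t - Y t * α t) ^ 2 / √(X t ^ 2 + Y t ^ 2) ^ 2 := by
  have h2 : √(X t ^ 2 + Y t ^ 2) ^ 2 = X t ^ 2 + Y t ^ 2 := Real.sq_sqrt (by positivity)
  set r := √(X t ^ 2 + Y t ^ 2)
  have hr : 0 < r := by linarith
  rw [div_pow, ← add_div, eq_div_iff (by positivity)]
  linear_combination (α t ^ 2 + β t ^ 2) * h2

lemma angular_le (H : FarArc h t₁ X Y α β U V Φ) (G : Outgoing t₁ T X Y α β) :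
    |X T * β T - Y T * α T| ≤ 8 / 25 := by
  have hr := H.four_le_dist G
  have hJ := H.jacobi_eq G
  rw [sq_speed_eq hr, sq_speed_eq H.dist_start.ge] at hJ
  have hs := H.sq_radialSpeed_le G
  have he := abs_le.1 H.energy_start
  have hl := abs_le.1 H.angular_start
  have hlT := (G.2 T ⟨G.1, le_rfl⟩).2
  have hh := abs_le.1 H.h_le
  have hΦ := abs_le.1 (H.potential_le T hr)
  have hΦ₁ := abs_le.1 (H.potential_le t₁ H.dist_start.ge)
  rw [H.dist_start] at *
  set l := X T * β T - Y T * α T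
  set l₁ := X t₁ * β t₁ - Y t₁ * α t₁
  set r := √(X T ^ 2 + Y T ^ 2)
  have h1 : 1 / (1000 * r) ≤ 1 / 4000 := by
    rw [div_le_div_iff₀ (by linarith) (by norm_num)]; linarith
  have h2 : 1 / r ≤ 1 / 4 := by gcongr
  have h3 : 1 / (1000 * r) ≤ 1 / r := by gcongr; linarith
  have h4 : l ^ 2 / r ^ 2 ≤ 1 / 64 := by
    rw [div_le_div_iff₀ (by positivity) (by norm_num)]
    have : l ^ 2 ≤ (1 / 2) ^ 2 := sq_le_sq' (abs_le.1 hlT).1 (abs_le.1 hlT).2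
    nlinarith
  have h5 : 0 ≤ l ^ 2 / r ^ 2 := by positivity
  have h6 : l₁ ^ 2 ≤ (1 / 1000) ^ 2 := sq_le_sq' hl.1 hl.2
  have h7 := sq_nonneg l₁
  have h8 := sq_nonneg ((X T * α T + Y T * β T) / r)
  rw [abs_le]
  constructor <;> linarith

lemma sq_radialSpeed_start_le (H : FarArc h t₁ X Y α β U V Φ) :
    ((X t₁ * α t₁ + Y t₁ * β t₁) / √(X t₁ ^ 2 + Y t₁ ^ 2)) ^ 2 ≤ 9 / 16 := by
  linarith [(abs_le.1 H.energy_start).2, (abs_le.1 H.h_le).2]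

lemma sq_speed_le (H : FarArc h t₁ X Y α β U V Φ) (G : Outgoing t₁ T X Y α β) :
    α T ^ 2 + β T ^ 2 ≤ 1 := by
  have hr := H.four_le_dist G
  have h1 := H.angular_le G
  rw [sq_speed_eq hr]
  have h2 := (H.sq_radialSpeed_le G).trans H.sq_radialSpeed_start_le
  have h3 : (X T * β T - Y T * α T) ^ 2 ≤ (8 / 25) ^ 2 := sq_le_sq' (abs_le.1 h1).1 (abs_le.1 h1).2
  have h4 : (X T * β T - Y T * α T) ^ 2 / √(X T ^ 2 + Y T ^ 2) ^ 2 ≤ 1 / 16 := by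
    rw [div_le_div_iff₀ (by positivity) (by norm_num)]
    nlinarith
  linarith

lemma time_le (H : FarArc h t₁ X Y α β U V Φ) (G : Outgoing t₁ T X Y α β) :
    T - t₁ ≤ √(X T ^ 2 + Y T ^ 2) ^ 2 := by
  have hr := H.four_le_dist G
  have h1 := H.radialSpeed_anti G ⟨le_rfl, G.1⟩
  have h2 : (X t₁ * α t₁ + Y t₁ * β t₁) / √(X t₁ ^ 2 + Y t₁ ^ 2) ≤ 3 / 4 :=
    abs_le_of_sq_le_sq' (by linarith [H.sq_radialSpeed_start_le]) (by norm_num) |>.2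
  have h3 := (G.2 T ⟨G.1, le_rfl⟩).1
  have h4 : 0 ≤ (X T * α T + Y T * β T) / √(X T ^ 2 + Y T ^ 2) := by positivity
  set r := √(X T ^ 2 + Y T ^ 2)
  have h5 : 9 / 10 / r ^ 2 * (T - t₁) ≤ 9 / 10 := by linarith
  have h6 : 9 / 10 / r ^ 2 * (T - t₁) = 9 / 10 * ((T - t₁) / r ^ 2) := by ring
  have h7 : (T - t₁) / r ^ 2 ≤ 1 := by linarith
  rwa [div_le_one (by positivity)] at h7

lemma outgoing_of_pos (H : FarArc h t₁ X Y α β U V Φ) (hT : t₁ ≤ T)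
    (hF : ∀ t ∈ Set.Ico t₁ T, 0 < max (X t * α t + Y t * β t) (4 - √(X t ^ 2 + Y t ^ 2))) :
    Outgoing t₁ T X Y α β := by
  have cX : Continuous X := continuous_iff_continuousAt.2 fun t => (H.dX t).continuousAt
  have cY : Continuous Y := continuous_iff_continuousAt.2 fun t => (H.dY t).continuousAt
  have cα : Continuous α := continuous_iff_continuousAt.2 fun t => (H.dα t).continuousAt
  have cβ : Continuous β := continuous_iff_continuousAt.2 fun t => (H.dβ t).continuousAt
  set g : ℝ → ℝ := fun t => min (X t * α t + Y t * β t) (1 / 2 - |X t * β t - Y t * α t|) with hg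
  have cg : Continuous g := by fun_prop
  have hg₁ : 0 < g t₁ := lt_min H.radial_start (by linarith [H.angular_start])
  have hpos : ∀ t ∈ Set.Ico t₁ T, 0 < g t := by
    intro t ht
    by_contra! hneg
    obtain ⟨s, hs, hs0, hs1⟩ := exists_first_zero cg ht.1 hg₁ hneg
    have G : Outgoing t₁ s X Y α β := by
      refine ⟨hs.1.le, fun r hr => ?_⟩
      have : 0 ≤ g r := by
        rcases hr.2.lt_or_eq with h | h
        · exact (hs1 r ⟨hr.1, h⟩).le
        · rw [h, hs0]
      exact ⟨this.trans (min_le_left _ _), by linarith [this.trans (min_le_right _ _)]⟩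
    have h1 := H.angular_le G
    have h2 := H.four_le_dist G
    have h3 := hF s ⟨hs.1.le, hs.2.trans_lt ht.2⟩
    have h4 : 0 < X s * α s + Y s * β s := by
      rcases lt_max_iff.1 h3 with h | h
      · exact h
      · linarith
    have h5 : 0 < g s := lt_min h4 (by linarith)
    linarith
  have hnn : ∀ t ∈ Set.Icc t₁ T, 0 ≤ g t := by
    intro t ht
    rcases hT.eq_or_lt with h | h
    · have : t = t₁ := le_antisymm (ht.2.trans h.ge) ht.1
      rw [this]; exact hg₁.le
    · have hcl : Set.Icc t₁ T ⊆ {t | 0 ≤ g t} := by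
        rw [← closure_Ico h.ne]
        exact closure_minimal (fun s hs => (hpos s hs).le) (isClosed_le continuous_const cg)
      exact hcl ht
  exact ⟨hT, fun t ht => ⟨(hnn t ht).trans (min_le_left _ _),
    by linarith [(hnn t ht).trans (min_le_right _ _)]⟩⟩

lemma eventually_neg (H : FarArc h t₁ X Y α β U V Φ) (G : Outgoing t₁ T X Y α β)
    (h0 : X T * α T + Y T * β T = 0) :
    ∀ᶠ s in 𝓝[>] T, max (X s * α s + Y s * β s) (4 - √(X s ^ 2 + Y s ^ 2)) < 0 := by
  have hr := H.four_le_dist G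
  have hT : t₁ < T := lt_of_le_of_ne G.1 fun h => by
    have := H.radial_start
    rw [h] at this
    linarith
  have hr' : 4 < √(X T ^ 2 + Y T ^ 2) := by
    have h1 := eventually_gt_of_hasDerivAt_pos (H.hasDerivAt_sq_dist t₁)
      (mul_pos two_pos H.radial_start)
    obtain ⟨s, hs, hs1, hs2⟩ := (h1.and (Ioo_mem_nhdsGT hT)).exists
    refine lt_of_lt_of_le ?_ (H.sqrt_mono G ⟨hs1.le, hs2.le⟩)
    rw [← H.dist_start]
    exact Real.sqrt_lt_sqrt (by positivity) hs
  have h2 : α T ^ 2 + β T ^ 2 + (X T * U T + Y T * V T) < 0 := by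
    rw [sq_speed_eq hr, h0]
    have h3 := (H.radial_bounds hr).2
    have h4 := abs_le.1 (H.angular_le G)
    have h5 : (X T * β T - Y T * α T) ^ 2 ≤ (8 / 25) ^ 2 := sq_le_sq' h4.1 h4.2
    set r := √(X T ^ 2 + Y T ^ 2)
    have h6 : (X T * β T - Y T * α T) ^ 2 / r ^ 2 ≤ (1 / 2) / r := by
      rw [div_le_div_iff₀ (by positivity) (by positivity)]
      nlinarith
    have h7 : -(999 / 1000) / r + 1 / 2 / r < 0 := by
      rw [← add_div]
      exact div_neg_of_neg_of_pos (by norm_num) (by linarith)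
    simp only [zero_div, ne_eq, OfNat.ofNat_ne_zero, not_false_eq_true, zero_pow, zero_add]
    linarith
  have h3 := eventually_gt_of_hasDerivAt_pos (H.hasDerivAt_radial T).neg (by linarith)
  have h4 : ∀ᶠ s in 𝓝 T, 4 < √(X s ^ 2 + Y s ^ 2) :=
    (H.hasDerivAt_dist hr).continuousAt.eventually (lt_mem_nhds hr')
  filter_upwards [h3, nhdsWithin_le_nhds h4] with s hs hs'
  simp only [Pi.neg_apply, h0] at hs
  exact max_lt (by linarith) (by linarith)

lemma radial_pos_of_energy (H : FarArc (1 / 40) t₁ X Y α β U V Φ)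
    (G : Outgoing t₁ T X Y α β) : 0 < X T * α T + Y T * β T := by
  have hr := H.four_le_dist G
  have hI := fun r (hr : r ∈ Set.Icc t₁ T) => H.four_le_dist (G.mono hr)
  have := le_of_hasDerivAt_nonneg (s := t₁) (t := T) (f := fun t =>
      ((X t * α t + Y t * β t) / √(X t ^ 2 + Y t ^ 2)) ^ 2 / 2 - 1001 / 1000 / √(X t ^ 2 + Y t ^ 2))
    G.1
    (fun r hr => (((H.hasDerivAt_radialSpeed (hI r hr)).pow 2).div_const 2).sub
      ((hasDerivAt_const r (1001 / 1000)).div (H.hasDerivAt_dist (hI r hr)) (by linarith [hI r hr])))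
    (fun t ht => by
      have h1 := hI t ht
      have h2 := (H.radial_bounds h1).1
      have h3 := (G.2 t ht).1
      set r := √(X t ^ 2 + Y t ^ 2)
      have hr : 0 < r := by linarith
      rw [div_le_iff₀ hr] at h2
      have h4 : 0 ≤ (X t * α t + Y t * β t) * (r * ((X t * U t + Y t * V t) * r + 1001 / 1000) +
        (X t * β t - Y t * α t) ^ 2) / r ^ 4 := by
        have : 0 ≤ (X t * U t + Y t * V t) * r + 1001 / 1000 := by linarith
        positivity
      refine h4.trans_eq ?_
      push_cast
      field_simp
      ring)
  have h1 := abs_le.1 H.energy_start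
  rw [H.dist_start] at *
  by_contra! hneg
  have h2 : X T * α T + Y T * β T = 0 := le_antisymm hneg (G.2 T ⟨G.1, le_rfl⟩).1
  have h3 : 0 < 1001 / 1000 / √(X T ^ 2 + Y T ^ 2) := by positivity
  simp only [h2] at this
  norm_num at this h1
  linarith

lemma dist_le_of_energy (H : FarArc (-(1 / 40)) t₁ X Y α β U V Φ)
    (G : Outgoing t₁ T X Y α β) : √(X T ^ 2 + Y T ^ 2) ≤ 100 := by
  have hr := H.four_le_dist G
  have hI := fun r (hr : r ∈ Set.Icc t₁ T) => H.four_le_dist (G.mono hr)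
  have := le_of_hasDerivAt_nonneg (s := t₁) (t := T) (f := fun t =>
      999 / 1000 / √(X t ^ 2 + Y t ^ 2) -
      (((X t * α t + Y t * β t) / √(X t ^ 2 + Y t ^ 2)) ^ 2 / 2 +
        32 / 625 / √(X t ^ 2 + Y t ^ 2) ^ 2))
    G.1
    (fun r hr => ((hasDerivAt_const r (999 / 1000)).div (H.hasDerivAt_dist (hI r hr))
      (by linarith [hI r hr])).sub ((((H.hasDerivAt_radialSpeed (hI r hr)).pow 2).div_const 2).add
      ((hasDerivAt_const r (32 / 625)).div ((H.hasDerivAt_dist (hI r hr)).pow 2)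
        (pow_ne_zero 2 (by linarith [hI r hr])))))
    (fun t ht => by
      have h1 := hI t ht
      have h2 := (H.radial_bounds h1).2
      have h3 := (G.2 t ht).1
      have h4 := abs_le.1 (H.angular_le (G.mono ht))
      have h5 : (X t * β t - Y t * α t) ^ 2 ≤ (8 / 25) ^ 2 := sq_le_sq' h4.1 h4.2
      simp only [Pi.pow_apply]
      set r := √(X t ^ 2 + Y t ^ 2)
      have hr : 0 < r := by linarith
      rw [le_div_iff₀ hr] at h2
      have h6 : 0 ≤ (X t * α t + Y t * β t) * (r * (-(X t * U t + Y t * V t) * r - 999 / 1000) +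
        ((8 / 25) ^ 2 - (X t * β t - Y t * α t) ^ 2)) / r ^ 4 := by
        have : 0 ≤ -(X t * U t + Y t * V t) * r - 999 / 1000 := by linarith
        have : 0 ≤ (8 / 25) ^ 2 - (X t * β t - Y t * α t) ^ 2 := by linarith
        positivity
      refine h6.trans_eq ?_
      push_cast
      field_simp
      ring)
  have h1 := abs_le.1 H.energy_start
  rw [H.dist_start] at *
  have h2 : 0 ≤ ((X T * α T + Y T * β T) / √(X T ^ 2 + Y T ^ 2)) ^ 2 / 2 +
        32 / 625 / √(X T ^ 2 + Y T ^ 2) ^ 2 := by positivity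
  have h3 : 1 / 100 ≤ 999 / 1000 / √(X T ^ 2 + Y T ^ 2) := by
    norm_num at *
    linarith
  rw [le_div_iff₀ (by linarith)] at h3
  linarith

end FarArc

/-- The vector field of the restricted three-body problem, in position relative to the first primary
and inertial velocity, with both Newtonian kernels truncated. -/
noncomputable def truncField (μ c : ℝ) (w : ℂ × ℂ) : ℂ × ℂ :=
  (w.2 - Complex.I • w.1, -(Complex.I • w.2) - (1 - μ) • truncKernel c w.1
    - μ • (truncKernel (1 / 8) (w.1 - 1) + 1))

lemma exists_lipschitzWith_truncField (μ : ℝ) {c : ℝ} (hc : 0 < c) :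
    ∃ K, LipschitzWith K (truncField μ c) := by
  have h1 := LipschitzWith.prod_fst (α := ℂ) (β := ℂ)
  have h2 := LipschitzWith.prod_snd (α := ℂ) (β := ℂ)
  have h3 := (lipschitzWith_truncKernel hc).comp h1
  have h4 := (lipschitzWith_truncKernel (c := 1 / 8) (by norm_num)).comp
    (h1.sub (LipschitzWith.const 1))
  exact ⟨_, (h2.sub ((lipschitzWith_smul Complex.I).comp h1)).prodMk
    ((((lipschitzWith_smul Complex.I).comp h2).neg.sub ((lipschitzWith_smul (1 - μ)).comp h3)).sub
      ((lipschitzWith_smul μ).comp (h4.add (LipschitzWith.const 1))))⟩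

/-- The reversing symmetry: reflection of positions in the axis of the primaries. -/
noncomputable def reversal : ℂ × ℂ →L[ℝ] ℂ × ℂ :=
  (Complex.conjCLE : ℂ →L[ℝ] ℂ).prodMap (-(Complex.conjCLE : ℂ →L[ℝ] ℂ))

lemma reversal_apply (w : ℂ × ℂ) :
    reversal w = ((starRingEnd ℂ) w.1, -(starRingEnd ℂ) w.2) := rfl

lemma reversal_reversal (w : ℂ × ℂ) : reversal (reversal w) = w := by
  simp [reversal_apply]

lemma truncField_reversal (μ c : ℝ) (w : ℂ × ℂ) :
    truncField μ c (reversal w) = -reversal (truncField μ c w) := by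
  have h := truncKernel_conj (1 / 8) (w.1 - 1)
  rw [map_sub, map_one] at h
  ext1
  · simp [reversal_apply, truncField]
    ring
  · simp only [reversal_apply, truncField, truncKernel_conj, h]
    simp

lemma reversal_symm {μ c : ℝ} (hc : 0 < c) {w : ℝ → ℂ × ℂ}
    (hw : ∀ t, HasDerivAt w (truncField μ c (w t)) t) {T : ℝ} (hT : reversal (w T) = w T) (t : ℝ) :
    w (2 * T - t) = reversal (w t) := by
  obtain ⟨K, hK⟩ := exists_lipschitzWith_truncField μ hc
  have h1 : ∀ t, HasDerivAt (fun t => reversal (w (2 * T - t)))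
      (truncField μ c (reversal (w (2 * T - t)))) t := by
    intro t
    rw [truncField_reversal]
    refine (reversal.hasFDerivAt.comp_hasDerivAt t ((hw (2 * T - t)).scomp t
      ((hasDerivAt_id t).const_sub (2 * T)))).congr_deriv ?_
    rw [neg_one_smul, map_neg]
  have h2 := ODE_solution_unique_univ (v := fun _ => truncField μ c) (s := fun _ => Set.univ)
    (t₀ := T) (fun _ => hK.lipschitzOnWith) (fun t => ⟨h1 t, trivial⟩) (fun t => ⟨hw t, trivial⟩)
    (by rw [two_mul, add_sub_cancel_right, hT])
  have h3 := congrFun h2 t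
  rw [← h3, reversal_reversal]

/-- Real form of the truncated equations of motion. -/
structure TruncSol (μ c : ℝ) (x y a b : ℝ → ℝ) : Prop where
  dx : ∀ t, HasDerivAt x (a t + y t) t
  dy : ∀ t, HasDerivAt y (b t - x t) t
  da : ∀ t, HasDerivAt a (b t - (1 - μ) * x t / max (√(x t ^ 2 + y t ^ 2)) c ^ 3
    - μ * ((x t - 1) / max (√((x t - 1) ^ 2 + y t ^ 2)) (1 / 8) ^ 3 + 1)) t
  db : ∀ t, HasDerivAt b (-a t - (1 - μ) * y t / max (√(x t ^ 2 + y t ^ 2)) c ^ 3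
    - μ * (y t / max (√((x t - 1) ^ 2 + y t ^ 2)) (1 / 8) ^ 3)) t

lemma truncKernel_re (c : ℝ) (z : ℂ) :
    (truncKernel c z).re = z.re / max (√(z.re ^ 2 + z.im ^ 2)) c ^ 3 := by
  rw [truncKernel, Complex.smul_re, smul_eq_mul, inv_mul_eq_div, Complex.norm_eq_sqrt_sq_add_sq]

lemma truncKernel_im (c : ℝ) (z : ℂ) :
    (truncKernel c z).im = z.im / max (√(z.re ^ 2 + z.im ^ 2)) c ^ 3 := by
  rw [truncKernel, Complex.smul_im, smul_eq_mul, inv_mul_eq_div, Complex.norm_eq_sqrt_sq_add_sq]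

lemma truncSol_of_truncField {μ c : ℝ} {w : ℝ → ℂ × ℂ}
    (hw : ∀ t, HasDerivAt w (truncField μ c (w t)) t) :
    TruncSol μ c (fun t => (w t).1.re) (fun t => (w t).1.im) (fun t => (w t).2.re)
      (fun t => (w t).2.im) := by
  have d1 := fun t => (ContinuousLinearMap.fst ℝ ℂ ℂ).hasFDerivAt.comp_hasDerivAt t (hw t)
  have d2 := fun t => (ContinuousLinearMap.snd ℝ ℂ ℂ).hasFDerivAt.comp_hasDerivAt t (hw t)
  constructor <;> intro t
  · refine (Complex.reCLM.hasFDerivAt.comp_hasDerivAt t (d1 t)).congr_deriv ?_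
    simp [truncField]
  · refine (Complex.imCLM.hasFDerivAt.comp_hasDerivAt t (d1 t)).congr_deriv ?_
    simp [truncField]
  · refine (Complex.reCLM.hasFDerivAt.comp_hasDerivAt t (d2 t)).congr_deriv ?_
    simp [truncField, truncKernel_re, truncKernel_im]
    ring
  · refine (Complex.imCLM.hasFDerivAt.comp_hasDerivAt t (d2 t)).congr_deriv ?_
    simp [truncField, truncKernel_re, truncKernel_im]
    ring

lemma abs_sqrt_shift_sub_le (x y s : ℝ) :
    |√((x - s) ^ 2 + y ^ 2) - √(x ^ 2 + y ^ 2)| ≤ |s| := by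
  have h := abs_norm_sub_norm_le (⟨x - s, y⟩ : ℂ) ⟨x, y⟩
  have e : (⟨x - s, y⟩ : ℂ) - ⟨x, y⟩ = ((-s : ℝ) : ℂ) := by
    apply Complex.ext <;> simp
  rw [e, Complex.norm_real, Real.norm_eq_abs, abs_neg] at h
  simpa only [Complex.norm_eq_sqrt_sq_add_sq] using h

lemma abs_div_max_cube_le (x y : ℝ) : |x / max (√(x ^ 2 + y ^ 2)) (1 / 8) ^ 3| ≤ 64 := by
  have h1 : |x| ≤ √(x ^ 2 + y ^ 2) := Real.abs_le_sqrt (by nlinarith [sq_nonneg y])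
  have h2 := le_max_left (√(x ^ 2 + y ^ 2)) (1 / 8)
  have h3 := le_max_right (√(x ^ 2 + y ^ 2)) (1 / 8)
  set m := max (√(x ^ 2 + y ^ 2)) (1 / 8)
  have hm : 0 < m := by linarith
  rw [abs_div, abs_of_pos (pow_pos hm 3), div_le_iff₀ (by positivity)]
  have h4 : 1 ≤ 64 * m ^ 2 := by nlinarith
  nlinarith

namespace TruncSol

variable {μ c h δ T t₁ : ℝ} {x y a b : ℝ → ℝ}

lemma continuous (S : TruncSol μ c x y a b) :
    Continuous x ∧ Continuous y ∧ Continuous a ∧ Continuous b :=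
  ⟨continuous_iff_continuousAt.2 fun t => (S.dx t).continuousAt,
    continuous_iff_continuousAt.2 fun t => (S.dy t).continuousAt,
    continuous_iff_continuousAt.2 fun t => (S.da t).continuousAt,
    continuous_iff_continuousAt.2 fun t => (S.db t).continuousAt⟩

/-- Initial conditions at a pericentre on the positive axis, and smallness of the parameters. -/
structure Pericentre (μ h δ : ℝ) (x y a b : ℝ → ℝ) : Prop where
  μ_pos : 0 < μ
  μ_le : μ ≤ 1 / 10 ^ 9
  h_le : |h| ≤ 1 / 40
  δ_pos : 0 < δ
  δ_le : δ ≤ 1 / 10 ^ 10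
  x_zero : x 0 = δ
  y_zero : y 0 = 0
  a_zero : a 0 = 0
  b_zero : b 0 = √(2 * ((1 - μ) / δ + h))

/-- The perturbing force of the second primary together with the frame acceleration. -/
noncomputable def perturbFst (μ : ℝ) (x y : ℝ → ℝ) (t : ℝ) : ℝ :=
  -(μ * ((x t - 1) / max (√((x t - 1) ^ 2 + y t ^ 2)) (1 / 8) ^ 3 + 1))

/-- The second component of the perturbing force of the second primary. -/
noncomputable def perturbSnd (μ : ℝ) (x y : ℝ → ℝ) (t : ℝ) : ℝ :=
  -(μ * (y t / max (√((x t - 1) ^ 2 + y t ^ 2)) (1 / 8) ^ 3))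

lemma nearArc (S : TruncSol μ (δ / 2) x y a b) (I : Pericentre μ h δ x y a b) (hT : 0 ≤ T)
    (hr : ∀ t ∈ Set.Icc 0 T, √((x t - μ) ^ 2 + y t ^ 2) ≤ 4)
    (hE : ∀ t ∈ Set.Icc 0 T, |(a t ^ 2 + b t ^ 2) / 2
      - (1 - μ) / max (√(x t ^ 2 + y t ^ 2)) (δ / 2) - h| ≤ 1 / 100)
    (hρ : ∀ t ∈ Set.Icc 0 T, 3 / 4 * δ ≤ √(x t ^ 2 + y t ^ 2)) :
    NearArc (1 - μ) h δ T x y a b (perturbFst μ x y) (perturbSnd μ x y) := by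
  have hμ := I.μ_pos
  have hμ' := I.μ_le
  have hδ := I.δ_pos
  have hm : ∀ t ∈ Set.Icc 0 T, max (√(x t ^ 2 + y t ^ 2)) (δ / 2) = √(x t ^ 2 + y t ^ 2) :=
    fun t ht => max_eq_left (by linarith [hρ t ht])
  refine ⟨by norm_num at *; linarith, by linarith, I.h_le, hδ, I.δ_le, hT,
    fun t ht => by linarith [hρ t ht], fun t _ => S.dx t, fun t _ => S.dy t,
    fun t ht => (S.da t).congr_deriv (by rw [hm t ht, perturbFst]; ring),
    fun t ht => (S.db t).congr_deriv (by rw [hm t ht, perturbSnd]; ring),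
    fun t _ => ?_, fun t _ => ?_, fun t ht => ?_, fun t ht => by rw [← hm t ht]; exact hE t ht,
    I.x_zero, I.y_zero, I.a_zero, I.b_zero⟩
  · rw [perturbFst, abs_neg, abs_mul, abs_of_pos hμ]
    have h1 := (abs_add_le _ 1).trans
      (add_le_add_left (abs_div_max_cube_le (x t - 1) (y t)) |1|)
    calc _ ≤ 1 / 10 ^ 9 * (64 + |(1 : ℝ)|) := by gcongr
      _ ≤ _ := by norm_num
  · rw [perturbSnd, abs_neg, abs_mul, abs_of_pos hμ, add_comm]
    have h1 := abs_div_max_cube_le (y t) (x t - 1)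
    calc _ ≤ 1 / 10 ^ 9 * (64 : ℝ) := by gcongr
      _ ≤ _ := by norm_num
  · have h1 := (abs_le.1 (abs_sqrt_shift_sub_le (x t) (y t) μ)).1
    rw [abs_of_pos hμ] at h1
    have h2 := hr t ht
    norm_num at *
    linarith

lemma exists_first_exit (S : TruncSol μ (δ / 2) x y a b) (I : Pericentre μ h δ x y a b) :
    ∃ t₁, 0 < t₁ ∧ t₁ ≤ 37 ∧ √((x t₁ - μ) ^ 2 + y t₁ ^ 2) = 4 ∧
      (∀ t ∈ Set.Ico 0 t₁, √((x t - μ) ^ 2 + y t ^ 2) < 4) ∧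
      NearArc (1 - μ) h δ t₁ x y a b (perturbFst μ x y) (perturbSnd μ x y) := by
  obtain ⟨cx, cy, ca, cb⟩ := S.continuous
  have hμ := I.μ_pos
  have hμ' := I.μ_le
  have hδ := I.δ_pos
  have hδ' := I.δ_le
  obtain ⟨m, hm⟩ : ∃ m : ℝ → ℝ, m = fun t => min (min (4 - √((x t - μ) ^ 2 + y t ^ 2))
    (1 / 100 - |(a t ^ 2 + b t ^ 2) / 2 - (1 - μ) / max (√(x t ^ 2 + y t ^ 2)) (δ / 2) - h|))
    (√(x t ^ 2 + y t ^ 2) - 3 / 4 * δ) := ⟨_, rfl⟩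
  have cm : Continuous m := by
    rw [hm]
    have : ∀ t, max (√(x t ^ 2 + y t ^ 2)) (δ / 2) ≠ 0 := fun t =>
      (lt_max_of_lt_right (by linarith)).ne'
    fun_prop (disch := assumption)
  have harc : ∀ T, 0 ≤ T → (∀ t ∈ Set.Icc 0 T, 0 ≤ m t) →
      NearArc (1 - μ) h δ T x y a b (perturbFst μ x y) (perturbSnd μ x y) := by
    intro T hT hmT
    simp only [hm, le_min_iff] at hmT
    exact S.nearArc I hT (fun t ht => by linarith [(hmT t ht).1.1])
      (fun t ht => by linarith [(hmT t ht).1.2]) (fun t ht => by linarith [(hmT t ht).2])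
  have hρ0 : √(x 0 ^ 2 + y 0 ^ 2) = δ := by
    rw [I.x_zero, I.y_zero]; simp [Real.sqrt_sq hδ.le]
  have hm0 : 0 < m 0 := by
    simp only [hm, lt_min_iff]
    refine ⟨⟨?_, ?_⟩, by rw [hρ0]; linarith⟩
    · have h1 := (abs_le.1 (abs_sqrt_shift_sub_le (x 0) (y 0) μ)).2
      rw [hρ0, abs_of_pos hμ] at h1
      norm_num at *
      linarith
    · have h1 : 1 / 2 ≤ (1 - μ) / δ := by
        rw [le_div_iff₀ hδ]; norm_num at *; linarith
      rw [hρ0, I.a_zero, I.b_zero, Real.sq_sqrt (by linarith [(abs_le.1 I.h_le).1]),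
        max_eq_left (by linarith)]
      have : (0 ^ 2 + 2 * ((1 - μ) / δ + h)) / 2 - (1 - μ) / δ - h = 0 := by ring
      rw [this]
      norm_num
  obtain ⟨t, ht, htm⟩ : ∃ t ∈ Set.Icc (0 : ℝ) 37, m t ≤ 0 := by
    by_contra! hcon
    have := (harc 37 (by norm_num) fun t ht => (hcon t ht).le).time_le
    norm_num at this
  obtain ⟨t₁, ht₁, h0, hpos⟩ := exists_first_zero cm ht.1 hm0 htm
  have A := harc t₁ ht₁.1.le fun s hs => by
    rcases hs.2.lt_or_eq with hlt | heq
    · exact (hpos s ⟨hs.1, hlt⟩).le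
    · rw [heq, h0]
  have hmem : t₁ ∈ Set.Icc 0 t₁ := ⟨ht₁.1.le, le_rfl⟩
  refine ⟨t₁, ht₁.1, ht₁.2.trans ht.2, ?_, fun s hs => ?_, A⟩
  · have h1 := A.energy_close hmem
    have h2 := A.le_dist hmem
    have h3 := A.dist_le t₁ hmem
    have h4 : 4 - √((x t₁ - μ) ^ 2 + y t₁ ^ 2) ≤ 0 := by
      by_contra! h5
      have : 0 < m t₁ := by
        simp only [hm, lt_min_iff]
        refine ⟨⟨h5, ?_⟩, by linarith⟩
        rw [max_eq_left (by linarith)]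
        norm_num at h1 ⊢
        linarith
      linarith
    have h6 : 0 ≤ 4 - √((x t₁ - μ) ^ 2 + y t₁ ^ 2) := by
      rw [← h0, hm]
      exact (min_le_left _ _).trans (min_le_left _ _)
    linarith
  · have := hpos s hs
    simp only [hm, lt_min_iff] at this
    linarith [this.1.1]

end TruncSol

/-- Distances to the two primaries, compared with the distance to the barycentre. -/
lemma far_dist_bounds {μ x y : ℝ} (hμ : 0 < μ) (hμ' : μ ≤ 1 / 10 ^ 9)
    (hr : 4 ≤ √((x - μ) ^ 2 + y ^ 2)) :
    |√(x ^ 2 + y ^ 2) - √((x - μ) ^ 2 + y ^ 2)| ≤ μ ∧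
    3 / 4 * √((x - μ) ^ 2 + y ^ 2) ≤ √(x ^ 2 + y ^ 2) ∧
    3 / 4 * √((x - μ) ^ 2 + y ^ 2) ≤ √((x - 1) ^ 2 + y ^ 2) := by
  have h1 := abs_sqrt_shift_sub_le x y μ
  have h2 := abs_sqrt_shift_sub_le (x - μ) y (1 - μ)
  norm_num at hμ'
  rw [sub_sub, add_sub_cancel, abs_of_pos (by linarith : 0 < 1 - μ)] at h2
  rw [abs_of_pos hμ, abs_sub_comm] at h1
  exact ⟨h1, by linarith [(abs_le.1 h1).1], by linarith [(abs_le.1 h2).1]⟩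

lemma abs_inv_sub_inv_le {μ r ρ : ℝ} (hr : 4 ≤ r) (hρ : 3 / 4 * r ≤ ρ) (h : |ρ - r| ≤ μ) :
    |1 / ρ - 1 / r| ≤ μ * (1 / r) := by
  have h1 : 1 / ρ - 1 / r = -(ρ - r) * (1 / ρ) * (1 / r) := by
    have : 0 < r := by linarith
    have : 0 < ρ := by linarith
    field_simp
    ring
  have h2 : 1 / ρ ≤ 1 := by
    rw [div_le_one (by linarith)]; linarith
  have h3 : 0 < 1 / r := by apply one_div_pos.2; linarith
  have h4 : 0 < 1 / ρ := by apply one_div_pos.2; linarith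
  rw [h1, abs_mul, abs_mul, abs_neg, abs_of_pos h3, abs_of_pos h4]
  have := abs_nonneg (ρ - r)
  gcongr
  nlinarith

lemma abs_div_cube_le {x y r : ℝ} (hr : 4 ≤ r) (h : 3 / 4 * r ≤ √(x ^ 2 + y ^ 2)) :
    |x / √(x ^ 2 + y ^ 2) ^ 3| ≤ 4 / 3 * (1 / r) := by
  have h1 : |x| ≤ √(x ^ 2 + y ^ 2) := Real.abs_le_sqrt (by nlinarith [sq_nonneg y])
  set ρ := √(x ^ 2 + y ^ 2)
  have hρ : 0 < ρ := by linarith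
  rw [abs_div, abs_of_pos (pow_pos hρ 3), mul_one_div, div_div,
    div_le_div_iff₀ (by positivity) (by linarith)]
  have : |x| * (3 * r) ≤ ρ * (4 * ρ) :=
    mul_le_mul h1 (by linarith) (by linarith) hρ.le
  nlinarith [mul_le_mul_of_nonneg_left (by linarith : 1 ≤ ρ) (by positivity : 0 ≤ ρ ^ 2)]

lemma far_potential_le {μ x y : ℝ} (hμ : 0 < μ) (hμ' : μ ≤ 1 / 10 ^ 9)
    (hr : 4 ≤ √((x - μ) ^ 2 + y ^ 2)) :
    |-(1 - μ) / √(x ^ 2 + y ^ 2) - μ / √((x - 1) ^ 2 + y ^ 2) + 1 / √((x - μ) ^ 2 + y ^ 2)| ≤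
      1 / (1000 * √((x - μ) ^ 2 + y ^ 2)) := by
  obtain ⟨h1, h2, h3⟩ := far_dist_bounds hμ hμ' hr
  set r := √((x - μ) ^ 2 + y ^ 2)
  set ρ := √(x ^ 2 + y ^ 2)
  set d := √((x - 1) ^ 2 + y ^ 2)
  have h4 := abs_le.1 (abs_inv_sub_inv_le hr h2 h1)
  have h5 : 0 < 1 / ρ := by apply one_div_pos.2; linarith
  have h6 : 0 < 1 / d := by apply one_div_pos.2; linarith
  have h7 : 1 / d ≤ 4 / 3 * (1 / r) := by
    rw [mul_one_div, div_div, div_le_div_iff₀ (by linarith) (by linarith)]; linarith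
  have h8 : 1 / ρ ≤ 4 / 3 * (1 / r) := by
    rw [mul_one_div, div_div, div_le_div_iff₀ (by linarith) (by linarith)]; linarith
  have e : 1 / (1000 * r) = 1 / 1000 * (1 / r) := by ring
  have e' : -(1 - μ) / ρ - μ / d + 1 / r = -(1 / ρ - 1 / r) + μ * (1 / ρ) - μ * (1 / d) := by ring
  rw [e, e', abs_le]
  norm_num at hμ'
  have h9 := mul_le_mul_of_nonneg_left h7 hμ.le
  have h10 := mul_le_mul_of_nonneg_left h8 hμ.le
  have h11 := mul_pos hμ h5
  have h12 := mul_pos hμ h6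
  have h0 : 0 < 1 / r := by apply one_div_pos.2; linarith
  have h13 := mul_le_mul_of_nonneg_right hμ' h0.le
  constructor <;> linarith

lemma far_radial_le {μ x y : ℝ} (hμ : 0 < μ) (hμ' : μ ≤ 1 / 10 ^ 9)
    (hr : 4 ≤ √((x - μ) ^ 2 + y ^ 2)) :
    |(x - μ) * (-((1 - μ) * x / √(x ^ 2 + y ^ 2) ^ 3) - μ * ((x - 1) / √((x - 1) ^ 2 + y ^ 2) ^ 3))
      + y * (-((1 - μ) * y / √(x ^ 2 + y ^ 2) ^ 3) - μ * (y / √((x - 1) ^ 2 + y ^ 2) ^ 3))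
      + 1 / √((x - μ) ^ 2 + y ^ 2)| ≤ 1 / (1000 * √((x - μ) ^ 2 + y ^ 2)) := by
  obtain ⟨h1, h2, h3⟩ := far_dist_bounds hμ hμ' hr
  have k1 : |x / √(x ^ 2 + y ^ 2) ^ 3| ≤ _ := abs_div_cube_le hr h2
  have k2 : |(x - 1) / √((x - 1) ^ 2 + y ^ 2) ^ 3| ≤ _ := abs_div_cube_le hr h3
  have q1 : √(x ^ 2 + y ^ 2) ^ 2 = x ^ 2 + y ^ 2 := Real.sq_sqrt (by positivity)
  have q2 : √((x - 1) ^ 2 + y ^ 2) ^ 2 = (x - 1) ^ 2 + y ^ 2 := Real.sq_sqrt (by positivity)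
  set r := √((x - μ) ^ 2 + y ^ 2)
  set ρ := √(x ^ 2 + y ^ 2)
  set d := √((x - 1) ^ 2 + y ^ 2)
  have hρ : 0 < ρ := by linarith
  have hd : 0 < d := by linarith
  have h4 := abs_le.1 (abs_inv_sub_inv_le hr h2 h1)
  have h5 : 0 < 1 / ρ := one_div_pos.2 hρ
  have h6 : 0 < 1 / d := one_div_pos.2 hd
  have h7 : 1 / d ≤ 4 / 3 * (1 / r) := by
    rw [mul_one_div, div_div, div_le_div_iff₀ (by linarith) (by linarith)]; linarith
  have h8 : 1 / ρ ≤ 4 / 3 * (1 / r) := by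
    rw [mul_one_div, div_div, div_le_div_iff₀ (by linarith) (by linarith)]; linarith
  have e : 1 / (1000 * r) = 1 / 1000 * (1 / r) := by ring
  have e1 : 1 / ρ = (x ^ 2 + y ^ 2) / ρ ^ 3 := by rw [← q1]; field_simp
  have e2 : 1 / d = ((x - 1) ^ 2 + y ^ 2) / d ^ 3 := by rw [← q2]; field_simp
  have e' : (x - μ) * (-((1 - μ) * x / ρ ^ 3) - μ * ((x - 1) / d ^ 3))
      + y * (-((1 - μ) * y / ρ ^ 3) - μ * (y / d ^ 3)) + 1 / r =
      -(1 / ρ - 1 / r) + μ * (1 / ρ) - μ * (1 / d) + (1 - μ) * μ * (x / ρ ^ 3)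
        - (1 - μ) * μ * ((x - 1) / d ^ 3) := by
    rw [e1, e2]; ring
  rw [e, e']
  norm_num at hμ'
  have h9 := mul_le_mul_of_nonneg_left h7 hμ.le
  have h10 := mul_le_mul_of_nonneg_left h8 hμ.le
  have h11 := mul_pos hμ h5
  have h12 := mul_pos hμ h6
  have h0 : 0 < 1 / r := by apply one_div_pos.2; linarith
  have h13 := mul_le_mul_of_nonneg_right hμ' h0.le
  have hb : ∀ z, |z| ≤ 4 / 3 * (1 / r) → |(1 - μ) * μ * z| ≤ μ * (4 / 3 * (1 / r)) := by
    intro z hz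
    rw [abs_mul, abs_of_nonneg (by nlinarith : 0 ≤ (1 - μ) * μ)]
    gcongr
    nlinarith
  have b1 := abs_le.1 (hb _ k1)
  have b2 := abs_le.1 (hb _ k2)
  rw [abs_le]
  constructor <;> linarith

namespace TruncSol

variable {μ c h δ T t₁ : ℝ} {x y a b : ℝ → ℝ}

/-- The force in barycentric coordinates, first component. -/
noncomputable def forceFst (μ c : ℝ) (x y : ℝ → ℝ) (t : ℝ) : ℝ :=
  -((1 - μ) * x t / max (√(x t ^ 2 + y t ^ 2)) c ^ 3)
    - μ * ((x t - 1) / max (√((x t - 1) ^ 2 + y t ^ 2)) (1 / 8) ^ 3)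

/-- The force in barycentric coordinates, second component. -/
noncomputable def forceSnd (μ c : ℝ) (x y : ℝ → ℝ) (t : ℝ) : ℝ :=
  -((1 - μ) * y t / max (√(x t ^ 2 + y t ^ 2)) c ^ 3)
    - μ * (y t / max (√((x t - 1) ^ 2 + y t ^ 2)) (1 / 8) ^ 3)

/-- The potential of the two primaries. -/
noncomputable def potential (μ : ℝ) (x y : ℝ → ℝ) (t : ℝ) : ℝ :=
  -(1 - μ) / √(x t ^ 2 + y t ^ 2) - μ / √((x t - 1) ^ 2 + y t ^ 2)

lemma hasDerivAt_potential (S : TruncSol μ c x y a b) {t : ℝ} (hρ : 0 < √(x t ^ 2 + y t ^ 2))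
    (hc : c ≤ √(x t ^ 2 + y t ^ 2)) (hd : 1 / 8 ≤ √((x t - 1) ^ 2 + y t ^ 2)) :
    HasDerivAt (potential μ x y)
      (-(forceFst μ c x y t * (a t + y t) + forceSnd μ c x y t * (b t - x t))) t := by
  have hd' : 0 < √((x t - 1) ^ 2 + y t ^ 2) := by linarith
  have d1 := hasDerivAt_sqrt_sq_add_sq (S.dx t) (S.dy t) hρ
  have d2 := hasDerivAt_sqrt_sq_add_sq ((S.dx t).sub_const 1) (S.dy t) hd'
  refine (((hasDerivAt_const t (-(1 - μ))).div d1 hρ.ne').sub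
    ((hasDerivAt_const t μ).div d2 hd'.ne')).congr_deriv ?_
  rw [forceFst, forceSnd, max_eq_left hc, max_eq_left hd]
  set ρ := √(x t ^ 2 + y t ^ 2)
  set d := √((x t - 1) ^ 2 + y t ^ 2)
  field_simp
  ring

set_option maxHeartbeats 1000000 in
lemma start_bounds {κ μ h x y a b : ℝ} (hκ : κ = 1 - μ) (hμ : 0 < μ) (hμ' : μ ≤ 1 / 10 ^ 9)
    (hh : |h| ≤ 1 / 40) (hr : √((x - μ) ^ 2 + y ^ 2) = 4) (hw : 0 ≤ x * a + y * b)
    (hL : |x * b - y * a| ≤ 1 / 10 ^ 4)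
    (hE : |(a ^ 2 + b ^ 2) / 2 - κ / √(x ^ 2 + y ^ 2) - h| ≤ 1 / 10 ^ 5) :
    |(x - μ) * (b - μ) - y * a| ≤ 1 / 1000 ∧ 0 < (x - μ) * a + y * (b - μ) ∧
      |(((x - μ) * a + y * (b - μ)) / 4) ^ 2 / 2 - 1 / 4 - h| ≤ 1 / 1000 := by
  obtain ⟨h1, h2, h3⟩ := far_dist_bounds hμ hμ' hr.ge
  have q1 : √(x ^ 2 + y ^ 2) ^ 2 = x ^ 2 + y ^ 2 := Real.sq_sqrt (by positivity)
  have hx : |x| ≤ √(x ^ 2 + y ^ 2) := Real.abs_le_sqrt (by nlinarith [sq_nonneg y])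
  have hy : |y| ≤ √(x ^ 2 + y ^ 2) := Real.abs_le_sqrt (by nlinarith [sq_nonneg x])
  have k := abs_le.1 (abs_inv_sub_inv_le hr.ge h2 h1)
  rw [hr] at h1 h2 k
  set ρ := √(x ^ 2 + y ^ 2)
  norm_num at hμ' hL hE k
  have hρ := abs_le.1 h1
  have hρ0 : 0 < ρ := by linarith
  have hA : 0 < ρ⁻¹ := inv_pos.2 hρ0
  have hE' := abs_le.1 hE
  have hh' := abs_le.1 hh
  have hL' := abs_le.1 hL
  have eκ : κ / ρ = ρ⁻¹ - μ * ρ⁻¹ := by rw [hκ]; ring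
  rw [eκ] at hE'
  have hm1 : 0 ≤ μ * ρ⁻¹ := by positivity
  have hm2 : μ * ρ⁻¹ ≤ 1 / 1000000000 := by nlinarith
  have hK1 : (a ^ 2 + b ^ 2) / 2 ≤ 1 / 4 + h + 11 / 1000000 := by linarith
  have hK2 : 1 / 4 + h - 11 / 1000000 ≤ (a ^ 2 + b ^ 2) / 2 := by linarith
  have ha : |a| ≤ 1 := abs_le_one_iff_mul_self_le_one.2 (by nlinarith [sq_nonneg b])
  have hb : |b| ≤ 1 := abs_le_one_iff_mul_self_le_one.2 (by nlinarith [sq_nonneg a])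
  have hx' : |x| ≤ 5 := by linarith
  have hy' : |y| ≤ 5 := by linarith
  have ha' := abs_le.1 ha
  have hb' := abs_le.1 hb
  have hx'' := abs_le.1 hx'
  have hy'' := abs_le.1 hy'
  have e1 : (x - μ) * (b - μ) - y * a = (x * b - y * a) - μ * (x + b - μ) := by ring
  have e2 : (x - μ) * a + y * (b - μ) = (x * a + y * b) - μ * (a + y) := by ring
  have m1 : |μ * (x + b - μ)| ≤ 1 / 1000000000 * 7 := by
    rw [abs_mul, abs_of_pos hμ]
    have : |x + b - μ| ≤ 7 := abs_le.2 ⟨by linarith, by linarith⟩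
    gcongr
  have m2 : |μ * (a + y)| ≤ 1 / 1000000000 * 7 := by
    rw [abs_mul, abs_of_pos hμ]
    have : |a + y| ≤ 7 := abs_le.2 ⟨by linarith, by linarith⟩
    gcongr
  have m1' := abs_le.1 m1
  have m2' := abs_le.1 m2
  have e3 : (x * a + y * b) ^ 2 + (x * b - y * a) ^ 2 = ρ ^ 2 * (a ^ 2 + b ^ 2) := by
    rw [q1]; ring
  have hLs : (x * b - y * a) ^ 2 ≤ 1 / 1000000 :=
    (sq_le_sq' hL'.1 hL'.2).trans (by norm_num)
  have hLs0 := sq_nonneg (x * b - y * a)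
  have hρs : (ρ - 4) ^ 2 ≤ 1 / 1000000000 := by
    refine (sq_le_sq' (b := 1 / 1000000000) (by linarith) (by linarith)).trans (by norm_num)
  have eρ : ρ ^ 2 = 16 + 8 * (ρ - 4) + (ρ - 4) ^ 2 := by ring
  have hρs0 := sq_nonneg (ρ - 4)
  have hρ1 : 16 - 1 / 10000000 ≤ ρ ^ 2 := by linarith
  have hρ2 : ρ ^ 2 ≤ 16 + 1 / 10000000 := by linarith
  have hK : 0 ≤ a ^ 2 + b ^ 2 := by positivity
  have p1 := mul_le_mul_of_nonneg_right hρ1 hK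
  have p2 := mul_le_mul_of_nonneg_right hρ2 hK
  set K := a ^ 2 + b ^ 2
  set w := x * a + y * b
  have hw1 : w ^ 2 ≤ 16 * K + 1 / 100000 := by linarith
  have hw2 : 16 * K - 1 / 100000 ≤ w ^ 2 := by linarith
  have hw3 : w ≤ 4 := by
    refine abs_le_of_sq_le_sq' (a := w) (b := 4) ?_ (by norm_num) |>.2
    linarith
  have hw4 : 1 ≤ w := by
    refine (sq_le_sq₀ zero_le_one hw).1 ?_
    linarith
  refine ⟨?_, by rw [e2]; linarith, ?_⟩
  · rw [e1, abs_le]; constructor <;> linarith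
  · rw [e2]
    set m := μ * (a + y)
    have e4 : ((w - m) / 4) ^ 2 / 2 = w ^ 2 / 32 - w * m / 16 + m ^ 2 / 32 := by ring
    have n1 : |w * m| ≤ 4 * (1 / 1000000000 * 7) := by
      rw [abs_mul, abs_of_nonneg hw]; gcongr
    have n1' := abs_le.1 n1
    have n2 : m ^ 2 ≤ 1 / 1000000 := (sq_le_sq' m2'.1 m2'.2).trans (by norm_num)
    rw [e4, abs_le]
    constructor <;> linarith [sq_nonneg m]

lemma farArc (S : TruncSol μ (δ / 2) x y a b) (I : Pericentre μ h δ x y a b)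
    (A : NearArc (1 - μ) h δ t₁ x y a b (perturbFst μ x y) (perturbSnd μ x y))
    (hr : √((x t₁ - μ) ^ 2 + y t₁ ^ 2) = 4) :
    FarArc h t₁ (fun t => x t - μ) y a (fun t => b t - μ) (forceFst μ (δ / 2) x y)
      (forceSnd μ (δ / 2) x y) (potential μ x y) := by
  have hμ := I.μ_pos
  have hμ' := I.μ_le
  have hδ' : δ / 2 ≤ 1 := by have := I.δ_le; norm_num at this; linarith
  have hm : t₁ ∈ Set.Icc 0 t₁ := ⟨A.T_nonneg, le_rfl⟩
  have hw : 0 ≤ x t₁ * a t₁ + y t₁ * b t₁ := by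
    linarith [A.le_w hm, A.T_nonneg]
  obtain ⟨s1, s2, s3⟩ := start_bounds rfl hμ hμ' I.h_le hr hw (A.angular_le hm)
    (A.energy_close hm)
  have hmax : ∀ t, 4 ≤ √((x t - μ) ^ 2 + y t ^ 2) →
      0 < √(x t ^ 2 + y t ^ 2) ∧ δ / 2 ≤ √(x t ^ 2 + y t ^ 2) ∧
        1 / 8 ≤ √((x t - 1) ^ 2 + y t ^ 2) := by
    intro t ht
    obtain ⟨-, h2, h3⟩ := far_dist_bounds hμ hμ' ht
    exact ⟨by linarith, by linarith, by linarith⟩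
  refine ⟨I.h_le, fun t => (S.dx t).sub_const μ, fun t => (S.dy t).congr_deriv (by ring),
    fun t => (S.da t).congr_deriv (by rw [forceFst]; ring),
    fun t => ((S.db t).sub_const μ).congr_deriv (by rw [forceSnd]; ring), fun t ht => ?_,
    fun t ht => ?_, fun t ht => far_potential_le hμ hμ' ht, hr, s1, s2, by rw [hr]; exact s3⟩
  · obtain ⟨h1, h2, h3⟩ := hmax t ht
    exact (S.hasDerivAt_potential h1 h2 h3).congr_deriv (by ring)
  · obtain ⟨-, h2, h3⟩ := hmax t ht
    rw [forceFst, forceSnd, max_eq_left h2, max_eq_left h3]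
    exact far_radial_le hμ hμ' ht

/-- At time `t₁` the solution leaves the disc of radius `4` about the barycentre. -/
structure FirstExit (μ h δ t₁ : ℝ) (x y a b : ℝ → ℝ) : Prop where
  pos : 0 < t₁
  le : t₁ ≤ 37
  lt_four : ∀ t ∈ Set.Ico 0 t₁, √((x t - μ) ^ 2 + y t ^ 2) < 4
  near : NearArc (1 - μ) h δ t₁ x y a b (perturbFst μ x y) (perturbSnd μ x y)
  far : FarArc h t₁ (fun t => x t - μ) y a (fun t => b t - μ) (forceFst μ (δ / 2) x y)
    (forceSnd μ (δ / 2) x y) (potential μ x y)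

lemma exists_firstExit (S : TruncSol μ (δ / 2) x y a b) (I : Pericentre μ h δ x y a b) :
    ∃ t₁, FirstExit μ h δ t₁ x y a b := by
  obtain ⟨t₁, h1, h2, h3, h4, A⟩ := S.exists_first_exit I
  exact ⟨t₁, h1, h2, h4, A, S.farArc I A h3⟩

/-- Positive until the first apocentre outside the disc of radius `4`. -/
noncomputable def apoFn (μ : ℝ) (x y a b : ℝ → ℝ) (t : ℝ) : ℝ :=
  max ((x t - μ) * a t + y t * (b t - μ)) (4 - √((x t - μ) ^ 2 + y t ^ 2))

lemma continuous_apoFn (S : TruncSol μ c x y a b) : Continuous (apoFn μ x y a b) := by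
  obtain ⟨cx, cy, ca, cb⟩ := S.continuous
  unfold apoFn
  fun_prop

namespace FirstExit

lemma apoFn_pos (E : FirstExit μ h δ t₁ x y a b) {t : ℝ} (ht : t ∈ Set.Ico 0 t₁) :
    0 < apoFn μ x y a b t :=
  lt_max_of_lt_right (by linarith [E.lt_four t ht])

lemma apoFn_zero_pos (E : FirstExit μ h δ t₁ x y a b) : 0 < apoFn μ x y a b 0 :=
  E.apoFn_pos ⟨le_rfl, E.pos⟩

lemma le_of_apoFn_nonpos (E : FirstExit μ h δ t₁ x y a b) (hT : 0 ≤ T)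
    (h0 : apoFn μ x y a b T ≤ 0) : t₁ ≤ T := by
  by_contra! hlt
  exact h0.not_gt (E.apoFn_pos ⟨hT, hlt⟩)

lemma outgoing (E : FirstExit μ h δ t₁ x y a b) (hT : t₁ ≤ T)
    (hF : ∀ t ∈ Set.Ico 0 T, 0 < apoFn μ x y a b t) :
    FarArc.Outgoing t₁ T (fun t => x t - μ) y a (fun t => b t - μ) :=
  E.far.outgoing_of_pos hT fun t ht => hF t ⟨E.pos.le.trans ht.1, ht.2⟩

lemma radial_eq_zero (E : FirstExit μ h δ t₁ x y a b) (hT : 0 ≤ T)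
    (h0 : apoFn μ x y a b T = 0) (hF : ∀ t ∈ Set.Ico 0 T, 0 < apoFn μ x y a b t) :
    (x T - μ) * a T + y T * (b T - μ) = 0 := by
  have hT' := E.le_of_apoFn_nonpos hT h0.le
  have := ((E.outgoing hT' hF).2 T ⟨hT', le_rfl⟩).1
  exact le_antisymm (h0 ▸ le_max_left _ _) this

lemma exists_apoFn_neg (E : FirstExit μ h δ t₁ x y a b) (hT : 0 ≤ T)
    (h0 : apoFn μ x y a b T = 0) (hF : ∀ t ∈ Set.Ico 0 T, 0 < apoFn μ x y a b t) {r : ℝ}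
    (hr : 0 < r) : ∃ s ∈ Set.Ioo T (T + r), apoFn μ x y a b s < 0 := by
  have hT' := E.le_of_apoFn_nonpos hT h0.le
  have h1 := E.far.eventually_neg (E.outgoing hT' hF) (E.radial_eq_zero hT h0 hF)
  obtain ⟨s, hs, hs'⟩ := (h1.and (Ioo_mem_nhdsGT (show T < T + r by linarith))).exists
  exact ⟨s, hs', hs⟩

lemma exists_apoFn_nonpos (E : FirstExit μ (-(1 / 40)) δ t₁ x y a b) :
    ∃ t, 0 ≤ t ∧ apoFn μ x y a b t ≤ 0 := by
  by_contra! hcon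
  have G := E.outgoing (T := t₁ + 10001) (by linarith) fun t ht => hcon t ht.1
  have h1 := E.far.time_le G
  have h2 := E.far.dist_le_of_energy G
  have h3 := pow_le_pow_left₀ (Real.sqrt_nonneg _) h2 2
  linarith

lemma apoFn_pos_of_energy (E : FirstExit μ (1 / 40) δ t₁ x y a b)
    (hc : Continuous (apoFn μ x y a b)) {t : ℝ} (ht : 0 ≤ t) : 0 < apoFn μ x y a b t := by
  by_contra! h0
  obtain ⟨s, hs, hs0, hpos⟩ := exists_first_zero hc ht E.apoFn_zero_pos h0
  have hs' := E.le_of_apoFn_nonpos hs.1.le hs0.le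
  exact (E.far.radial_pos_of_energy (E.outgoing hs' hpos)).ne' (E.radial_eq_zero hs.1.le hs0 hpos)

/-- The solution stays away from both primaries up to its first apocentre. -/
lemma dist_primaries (E : FirstExit μ h δ t₁ x y a b) (I : Pericentre μ h δ x y a b)
    (hT : t₁ ≤ T) (hF : ∀ t ∈ Set.Ico 0 T, 0 < apoFn μ x y a b t) {t : ℝ} (ht : t ∈ Set.Icc 0 T) :
    δ ≤ √(x t ^ 2 + y t ^ 2) ∧ 1 / 8 ≤ √((x t - 1) ^ 2 + y t ^ 2) := by
  rcases le_total t t₁ with h1 | h1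
  · have hm : t ∈ Set.Icc 0 t₁ := ⟨ht.1, h1⟩
    exact ⟨E.near.le_dist hm, by linarith [E.near.le_dist_secondary hm]⟩
  · have h2 : 4 ≤ √((x t - μ) ^ 2 + y t ^ 2) :=
      E.far.four_le_dist ((E.outgoing hT hF).mono ⟨h1, ht.2⟩)
    obtain ⟨-, h3, h4⟩ := far_dist_bounds I.μ_pos I.μ_le h2
    have h5 := I.δ_le
    norm_num at h5
    exact ⟨by linarith, by linarith⟩

end FirstExit

/-- Angular speed about the first primary in the rotating frame. -/
noncomputable def angularSpeed (c x y a b : ℝ) : ℝ :=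
  (x * b - y * a - (x ^ 2 + y ^ 2)) / max (√(x ^ 2 + y ^ 2)) c ^ 2

lemma continuous_angularSpeed {α : Type*} [TopologicalSpace α] (hc : 0 < c) {x y a b : α → ℝ}
    (hx : Continuous x) (hy : Continuous y) (ha : Continuous a) (hb : Continuous b) :
    Continuous fun s => angularSpeed c (x s) (y s) (a s) (b s) := by
  have : ∀ s, max (√(x s ^ 2 + y s ^ 2)) c ^ 2 ≠ 0 := fun s =>
    pow_ne_zero 2 (lt_max_of_lt_right hc).ne'
  unfold angularSpeed
  fun_prop (disch := assumption)

lemma mul_sin_eq_mul_cos (S : TruncSol μ c x y a b) (hT : 0 ≤ T)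
    (hρ : ∀ t ∈ Set.Icc 0 T, 0 < √(x t ^ 2 + y t ^ 2) ∧ c ≤ √(x t ^ 2 + y t ^ 2))
    (hy : y 0 = 0) {θ : ℝ → ℝ} (hθ : θ 0 = 0)
    (dθ : ∀ t, HasDerivAt θ (angularSpeed c (x t) (y t) (a t) (b t)) t) :
    x T * sin (θ T) = y T * cos (θ T) := by
  have := abs_sub_le_of_hasDerivAt (C := 0) (f' := fun _ => 0)
    (f := fun t => (y t * cos (θ t) - x t * sin (θ t)) / √(x t ^ 2 + y t ^ 2)) hT
    (fun t ht => ((((S.dy t).mul (dθ t).cos).sub ((S.dx t).mul (dθ t).sin)).div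
      (hasDerivAt_sqrt_sq_add_sq (S.dx t) (S.dy t) (hρ t ht).1) (hρ t ht).1.ne').congr_deriv (by
        have h1 := (hρ t ht).1
        have h2 : √(x t ^ 2 + y t ^ 2) ^ 2 = x t ^ 2 + y t ^ 2 := Real.sq_sqrt (by positivity)
        rw [angularSpeed, max_eq_left (hρ t ht).2]
        set ρ := √(x t ^ 2 + y t ^ 2)
        simp only [Pi.mul_apply, Pi.sub_apply]
        field_simp
        linear_combination ((b t - x t) * cos (θ t) - sin (θ t) * (a t + y t)) * h2))
    (fun _ _ => by simp)
  rw [zero_mul, hθ, hy] at this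
  have h0 := abs_nonpos_iff.1 this
  simp only [cos_zero, sin_zero, mul_zero, sub_zero, zero_mul, zero_div, sub_self] at h0
  rcases div_eq_zero_iff.1 h0 with h1 | h1
  · linarith
  · exact absurd h1 (hρ T ⟨hT, le_rfl⟩).1.ne'

lemma FirstExit.angularSpeed_le (E : FirstExit μ h δ t₁ x y a b) (I : Pericentre μ h δ x y a b)
    (hT : t₁ ≤ T) (hF : ∀ t ∈ Set.Ico 0 T, 0 < apoFn μ x y a b t) :
    angularSpeed (δ / 2) (x T) (y T) (a T) (b T) ≤ -(1 / 2) := by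
  have hμ := I.μ_pos
  have hμ' := I.μ_le
  have hδ := I.δ_le
  norm_num at hμ' hδ
  have G := E.outgoing hT hF
  obtain ⟨-, h2, -⟩ := far_dist_bounds hμ I.μ_le (E.far.four_le_dist G)
  have h3 := E.far.four_le_dist G
  have h4 := abs_le.1 (E.far.angular_le G)
  have h5 := E.far.sq_speed_le G
  have q : √(x T ^ 2 + y T ^ 2) ^ 2 = x T ^ 2 + y T ^ 2 := Real.sq_sqrt (by positivity)
  have hx : |x T| ≤ √(x T ^ 2 + y T ^ 2) := Real.abs_le_sqrt (by nlinarith [sq_nonneg (y T)])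
  rw [angularSpeed, max_eq_left (by linarith)]
  set ρ := √(x T ^ 2 + y T ^ 2)
  have hρ : 3 ≤ ρ := by linarith
  rw [div_le_iff₀ (by positivity)]
  have hb : b T - μ ≤ 1 := by nlinarith [sq_nonneg (a T)]
  have hx' := (abs_le.1 hx).2
  have h6 : μ * (x T + b T) ≤ μ * (ρ + 2) := by gcongr; linarith
  have h7 : μ * (ρ + 2) ≤ 1 / 1000000000 * (ρ + 2) := by gcongr
  nlinarith [sq_nonneg μ]

lemma FirstExit.angle_le (E : FirstExit μ h δ t₁ x y a b) (I : Pericentre μ h δ x y a b)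
    (hT : t₁ ≤ T) (hF : ∀ t ∈ Set.Ico 0 T, 0 < apoFn μ x y a b t) {θ : ℝ → ℝ}
    (dθ : ∀ t, HasDerivAt θ (angularSpeed (δ / 2) (x t) (y t) (a t) (b t)) t) :
    θ T ≤ θ t₁ - (T - 37) / 2 := by
  have := le_of_hasDerivAt_nonneg (f := fun t => -θ t - t / 2) hT
    (fun t _ => (dθ t).neg.sub ((hasDerivAt_id t).div_const 2)) fun t ht => by
      linarith [E.angularSpeed_le I ht.1 fun s hs => hF s ⟨hs.1, hs.2.trans_le ht.2⟩]
  linarith [E.le]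

/-- In a family of pericentre launches with energies in `[-1/40, 1/40]` there are solutions that
reach an apocentre on the axis of the primaries after an arbitrarily long time. -/
lemma exists_axis_apocentre {μ δ : ℝ} {x y a b : ℝ → ℝ → ℝ} (hδ : 0 < δ)
    (hx : Continuous (Function.uncurry x)) (hy : Continuous (Function.uncurry y))
    (ha : Continuous (Function.uncurry a)) (hb : Continuous (Function.uncurry b))
    (S : ∀ h, TruncSol μ (δ / 2) (x h) (y h) (a h) (b h))
    (I : ∀ h ∈ Set.Icc (-(1 / 40)) (1 / 40), Pericentre μ h δ (x h) (y h) (a h) (b h)) (M : ℝ) :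
    ∃ h ∈ Set.Icc (-(1 / 40) : ℝ) (1 / 40), ∃ T, M ≤ T ∧ 0 < T ∧
      apoFn μ (x h) (y h) (a h) (b h) T = 0 ∧
      (∀ t ∈ Set.Ico 0 T, 0 < apoFn μ (x h) (y h) (a h) (b h) t) ∧ y h T = 0 := by
  have hE : ∀ h ∈ Set.Icc (-(1 / 40) : ℝ) (1 / 40),
      ∃ t₁, FirstExit μ h δ t₁ (x h) (y h) (a h) (b h) :=
    fun h hh => (S h).exists_firstExit (I h hh)
  have hF : Continuous (Function.uncurry fun h => apoFn μ (x h) (y h) (a h) (b h)) := by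
    simp only [Function.uncurry_def] at hx hy ha hb ⊢
    unfold apoFn
    fun_prop
  obtain ⟨c, hc, τ, cτ, hτ, hτF⟩ := exists_exit_time hF (a := -(1 / 40)) (b := 1 / 40)
    (by norm_num) (fun h hh => (hE h hh).choose_spec.apoFn_zero_pos)
    (by
      obtain ⟨t₁, E⟩ := hE (-(1 / 40)) ⟨le_rfl, by norm_num⟩
      exact E.exists_apoFn_nonpos)
    (fun t ht => by
      obtain ⟨t₁, E⟩ := hE (1 / 40) ⟨by norm_num, le_rfl⟩
      exact E.apoFn_pos_of_energy (S _).continuous_apoFn ht)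
    (fun h hh T hT h0 hpos r hr => (hE h hh).choose_spec.exists_apoFn_neg hT.le h0 hpos hr)
  have hsub : Set.Ico (-(1 / 40)) c ⊆ Set.Icc (-(1 / 40)) (1 / 40) :=
    fun h hh => ⟨hh.1, hh.2.le.trans hc.2⟩
  have cω : Continuous (Function.uncurry fun h t =>
      angularSpeed (δ / 2) (x h t) (y h t) (a h t) (b h t)) :=
    continuous_angularSpeed (half_pos hδ) hx hy ha hb
  obtain ⟨θ, hθ⟩ : ∃ θ : ℝ → ℝ → ℝ, θ = fun h t =>
    ∫ s in (0 : ℝ)..t, angularSpeed (δ / 2) (x h s) (y h s) (a h s) (b h s) := ⟨_, rfl⟩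
  have cθ : Continuous (Function.uncurry θ) := by
    rw [hθ]
    exact intervalIntegral.continuous_parametric_intervalIntegral_of_continuous
      (f := fun (p : ℝ × ℝ) t => angularSpeed (δ / 2) (x p.1 t) (y p.1 t) (a p.1 t) (b p.1 t))
      (cω.comp (by fun_prop : Continuous fun q : (ℝ × ℝ) × ℝ => (q.1.1, q.2))) continuous_snd
  have dθ : ∀ h t, HasDerivAt (θ h)
      (angularSpeed (δ / 2) (x h t) (y h t) (a h t) (b h t)) t := fun h t => by
    rw [hθ]
    have : Continuous fun t => angularSpeed (δ / 2) (x h t) (y h t) (a h t) (b h t) :=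
      cω.comp (Continuous.prodMk_right h)
    exact (this.integral_hasStrictDerivAt 0 t).hasDerivAt
  have θ0 : ∀ h, θ h 0 = 0 := fun h => by simp [hθ]
  obtain ⟨C, hC⟩ := ((isCompact_Icc (a := (-(1 / 40) : ℝ)) (b := 1 / 40)).prod
    (isCompact_Icc (a := (0 : ℝ)) (b := 37))).exists_bound_of_continuousOn cθ.continuousOn
  have hθτ : ∀ h ∈ Set.Ico (-(1 / 40)) c, θ h (τ h) ≤ C - (τ h - 37) / 2 := by
    intro h hh
    obtain ⟨h1, h2, h3⟩ := hτF h hh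
    obtain ⟨t₁, E⟩ := hE h (hsub hh)
    have h4 := E.angle_le (I h (hsub hh)) (E.le_of_apoFn_nonpos h1.le h2.le) h3 (dθ h)
    have h5 := (le_abs_self _).trans (hC (h, t₁) ⟨hsub hh, E.pos.le, E.le⟩)
    simp only [Function.uncurry_apply_pair] at h5
    linarith
  have cψ : ContinuousOn (fun h => θ h (τ h)) (Set.Ico (-(1 / 40)) c) :=
    cθ.comp_continuousOn (continuousOn_id.prodMk cτ)
  obtain ⟨l, hl, hlM⟩ := mem_nhdsLT_iff_exists_Ico_subset.1
    (hτ.eventually_ge_atTop M)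
  obtain ⟨h₁, hh₁⟩ : ∃ h₁, h₁ = max l (-(1 / 40)) := ⟨_, rfl⟩
  have h₁c : h₁ < c := hh₁ ▸ max_lt hl hc.1
  have h₁a : -(1 / 40) ≤ h₁ := hh₁ ▸ le_max_right _ _
  have h₁l : l ≤ h₁ := hh₁ ▸ le_max_left _ _
  obtain ⟨k, hk⟩ := exists_nat_ge (-θ h₁ (τ h₁) / π)
  rw [div_le_iff₀ pi_pos] at hk
  obtain ⟨h₂, hh₂, hh₂'⟩ := ((hτ.eventually_ge_atTop (37 + 2 * (C + k * π))).and
    (Ioo_mem_nhdsLT h₁c)).exists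
  have hI : Set.Icc h₁ h₂ ⊆ Set.Ico (-(1 / 40)) c := fun h hh =>
    ⟨h₁a.trans hh.1, hh.2.trans_lt hh₂'.2⟩
  have hψ₂ : θ h₂ (τ h₂) ≤ -(k * π) := by
    linarith [hθτ h₂ (hI ⟨hh₂'.1.le, le_rfl⟩)]
  obtain ⟨h, hh, hψ⟩ := intermediate_value_Icc' hh₂'.1.le (cψ.mono hI)
    ⟨hψ₂, (by linarith : -(k * π) ≤ θ h₁ (τ h₁))⟩
  have hhI := hI hh
  obtain ⟨h1, h2, h3⟩ := hτF h hhI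
  refine ⟨h, hsub hhI, τ h, hlM ⟨h₁l.trans hh.1, hhI.2⟩, h1, h2, h3, ?_⟩
  obtain ⟨t₁, E⟩ := hE h (hsub hhI)
  have hT := E.le_of_apoFn_nonpos h1.le h2.le
  have h4 := (S h).mul_sin_eq_mul_cos h1.le (fun t ht => by
    have := (E.dist_primaries (I h (hsub hhI)) hT h3 ht).1
    exact ⟨by linarith, by linarith⟩) (I h (hsub hhI)).y_zero (θ0 h) (dθ h)
  have hsin : sin (-(k * π)) = 0 := by rw [sin_neg, sin_nat_mul_pi, neg_zero]
  simp only at hψ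
  rw [hψ, hsin, mul_zero] at h4
  refine (mul_eq_zero.1 h4.symm).resolve_right fun hcos => ?_
  have := sin_sq_add_cos_sq (-(k * π))
  rw [hsin, hcos] at this
  norm_num at this

end TruncSol

lemma TruncSol.isPCRTBPSol {μ c : ℝ} {x y a b : ℝ → ℝ} (S : TruncSol μ c x y a b) (hc : 0 < c)
    (hρ : ∀ t, c ≤ √(x t ^ 2 + y t ^ 2)) (hd : ∀ t, 1 / 8 ≤ √((x t - 1) ^ 2 + y t ^ 2)) :
    IsPCRTBPSol μ Set.univ (fun t => x t - μ) y a (fun t => b t - μ) := by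
  intro t _
  have e1 : dS μ (x t - μ) (y t) = √(x t ^ 2 + y t ^ 2) := by rw [dS, sub_add_cancel]
  have e2 : dJ μ (x t - μ) (y t) = √((x t - 1) ^ 2 + y t ^ 2) := by
    rw [dJ, show x t - μ - (1 - μ) = x t - 1 by ring]
  have da := S.da t
  have db := S.db t
  have h1 := hρ t
  have h2 := hd t
  rw [max_eq_left h1, max_eq_left h2] at da db
  refine ⟨⟨fun h => ?_, fun h => ?_⟩, (S.dx t).sub_const μ, (S.dy t).congr_deriv (by ring), ?_, ?_⟩
  · rw [Prod.mk.injEq] at h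
    have hx : x t = 0 := by linarith
    rw [hx, h.2] at h1
    norm_num at h1
    linarith
  · rw [Prod.mk.injEq] at h
    have hx : x t = 1 := by linarith
    rw [hx, h.2] at h2
    norm_num at h2
  · exact da.congr_deriv (by rw [e1, e2]; ring)
  · exact (db.sub_const μ).congr_deriv (by rw [e1, e2]; ring)

lemma reversal_eq_self {w : ℂ × ℂ} (h1 : w.1.im = 0) (h2 : w.2.re = 0) : reversal w = w := by
  rw [reversal_apply]
  refine Prod.ext (Complex.ext ?_ ?_) (Complex.ext ?_ ?_) <;> simp [h1, h2]

/-- A solution symmetric about two times `0` and `T` is `2 * T`-periodic. -/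
lemma periodic_of_reversal {μ c : ℝ} (hc : 0 < c) {w : ℝ → ℂ × ℂ}
    (hw : ∀ t, HasDerivAt w (truncField μ c (w t)) t) {T : ℝ} (h0 : reversal (w 0) = w 0)
    (hT : reversal (w T) = w T) : Function.Periodic w (2 * T) := by
  intro t
  have h1 := reversal_symm hc hw hT (-t)
  have h2 := reversal_symm hc hw h0 t
  rw [mul_zero, zero_sub] at h2
  rw [h2, reversal_reversal] at h1
  rw [← h1]
  congr 1
  ring

lemma exists_pericentre_family {μ δ : ℝ} (hδ : 0 < δ) :
    ∃ w : ℝ → ℝ → ℂ × ℂ, Continuous (Function.uncurry w) ∧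
      (∀ h t, HasDerivAt (w h) (truncField μ (δ / 2) (w h t)) t) ∧
      ∀ h, w h 0 = (⟨δ, 0⟩, ⟨0, √(2 * ((1 - μ) / δ + h))⟩) := by
  obtain ⟨K, hK⟩ := exists_lipschitzWith_truncField μ (half_pos hδ)
  obtain ⟨φ, φ0, dφ, cφ⟩ := exists_global_flow hK
  refine ⟨fun h => φ (⟨δ, 0⟩, ⟨0, √(2 * ((1 - μ) / δ + h))⟩), ?_, fun h => dφ _, fun h => φ0 _⟩
  have e : ∀ s : ℝ, (⟨0, s⟩ : ℂ) = s * Complex.I := fun s => by apply Complex.ext <;> simp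
  have hc : Continuous fun h : ℝ =>
      ((⟨δ, 0⟩, ⟨0, √(2 * ((1 - μ) / δ + h))⟩) : ℂ × ℂ) := by
    simp only [e]
    fun_prop
  exact cφ.comp ((hc.comp continuous_fst).prodMk continuous_snd)

lemma exists_symmetric_orbit {μ δ : ℝ} (hμ : 0 < μ) (hμ' : μ ≤ 1 / 10 ^ 9) (hδ : 0 < δ)
    (hδ' : δ ≤ 1 / 10 ^ 10) (R : ℝ) :
    ∃ (w : ℝ → ℂ × ℂ) (T : ℝ), 0 < T ∧ (∀ t, HasDerivAt w (truncField μ (δ / 2) (w t)) t) ∧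
      w 0 = (⟨δ, 0⟩, ⟨0, (w 0).2.im⟩) ∧ reversal (w T) = w T ∧
      R ≤ √(((w T).1.re - μ) ^ 2 + (w T).1.im ^ 2) ∧
      ∀ t ∈ Set.Icc 0 T, δ ≤ √((w t).1.re ^ 2 + (w t).1.im ^ 2) ∧
        1 / 8 ≤ √(((w t).1.re - 1) ^ 2 + (w t).1.im ^ 2) := by
  obtain ⟨w, cw, dw, w0⟩ := exists_pericentre_family (μ := μ) hδ
  have S := fun h => truncSol_of_truncField (dw h)
  have I : ∀ h ∈ Set.Icc (-(1 / 40) : ℝ) (1 / 40), TruncSol.Pericentre μ h δ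
      (fun t => (w h t).1.re) (fun t => (w h t).1.im) (fun t => (w h t).2.re)
      (fun t => (w h t).2.im) := fun h hh =>
    ⟨hμ, hμ', abs_le.2 hh, hδ, hδ', by simp [w0], by simp [w0], by simp [w0], by simp [w0]⟩
  obtain ⟨h, hh, T, hTM, hT, h0, hpos, hy⟩ := TruncSol.exists_axis_apocentre
    (x := fun h t => (w h t).1.re) (y := fun h t => (w h t).1.im)
    (a := fun h t => (w h t).2.re) (b := fun h t => (w h t).2.im) hδ
    (Complex.continuous_re.comp (continuous_fst.comp cw))
    (Complex.continuous_im.comp (continuous_fst.comp cw))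
    (Complex.continuous_re.comp (continuous_snd.comp cw))
    (Complex.continuous_im.comp (continuous_snd.comp cw)) S I (37 + R ^ 2)
  obtain ⟨t₁, E⟩ := (S h).exists_firstExit (I h hh)
  have hT₁ := E.le_of_apoFn_nonpos hT.le h0.le
  have G := E.outgoing hT₁ hpos
  have hr := E.far.four_le_dist G
  have ht := E.far.time_le G
  have hrad := E.radial_eq_zero hT.le h0 hpos
  refine ⟨w h, T, hT, dw h, by simp [w0], reversal_eq_self hy ?_, ?_,
    fun t ht => E.dist_primaries (I h hh) hT₁ hpos ht⟩
  · rw [hy, zero_mul, add_zero] at hrad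
    refine (mul_eq_zero.1 hrad).resolve_left fun hx => ?_
    rw [hx, hy] at hr
    norm_num at hr
  · exact (le_abs_self R).trans (abs_le_of_sq_le_sq (by linarith [E.le]) (Real.sqrt_nonneg _))

/-- There is `μ₀ ∈ (0,1/2]` such that for every `μ ∈ (0,μ₀)` and every `ε > 0` the PCRTBP
has a periodic solution whose supremum of `‖q‖` is at least `ε⁻¹` and whose infimum of the
distance to the first primary `(-μ,0)` is at most `ε`. -/
theorem large_periodic_orbits_close_to_collision :
    ∃ μ₀ : ℝ, μ₀ ∈ Set.Ioc (0 : ℝ) (1 / 2) ∧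
      ∀ μ ∈ Set.Ioo (0 : ℝ) μ₀, ∀ ε : ℝ, 0 < ε →
        ∃ (q1 q2 p1 p2 : ℝ → ℝ) (T : ℝ), 0 < T ∧
          IsPCRTBPSol μ Set.univ q1 q2 p1 p2 ∧
          (∀ t : ℝ, q1 (t + T) = q1 t ∧ q2 (t + T) = q2 t ∧
            p1 (t + T) = p1 t ∧ p2 (t + T) = p2 t) ∧
          (∀ c : ℝ, c < ε⁻¹ → ∃ t : ℝ, c < nrm2 (q1 t) (q2 t)) ∧
          (∀ c : ℝ, ε < c → ∃ t : ℝ, nrm2 (q1 t + μ) (q2 t) < c) := by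
  refine ⟨1 / 10 ^ 9, by norm_num, fun μ hμ ε hε => ?_⟩
  have hδ : 0 < min ε (1 / 10 ^ 10) := lt_min hε (by norm_num)
  obtain ⟨w, T, hT, dw, w0, wT, hR, hP⟩ :=
    exists_symmetric_orbit hμ.1 hμ.2.le hδ (min_le_right _ _) ε⁻¹
  have hδε : min ε (1 / 10 ^ 10) ≤ ε := min_le_left _ _
  set δ := min ε (1 / 10 ^ 10)
  have S := truncSol_of_truncField dw
  have hper := periodic_of_reversal (half_pos hδ) dw
    (reversal_eq_self (by rw [w0]) (by rw [w0])) wT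
  have hP' : ∀ t, δ ≤ √((w t).1.re ^ 2 + (w t).1.im ^ 2) ∧
      1 / 8 ≤ √(((w t).1.re - 1) ^ 2 + (w t).1.im ^ 2) := by
    intro t
    obtain ⟨s, hs, hts⟩ := hper.exists_mem_Ico₀ (by linarith) t
    rw [hts]
    rcases le_total s T with h | h
    · exact hP s ⟨hs.1, h⟩
    · have h1 := reversal_symm (half_pos hδ) dw wT (2 * T - s)
      rw [sub_sub_cancel] at h1
      rw [h1]
      simpa [reversal_apply] using hP (2 * T - s) ⟨by linarith [hs.2], by linarith⟩
  refine ⟨_, _, _, _, 2 * T, by linarith, S.isPCRTBPSol (half_pos hδ)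
    (fun t => by linarith [(hP' t).1]) (fun t => (hP' t).2), fun t => ?_,
    fun c hc => ⟨T, hc.trans_le hR⟩, fun c hc => ⟨0, ?_⟩⟩
  · simp only [hper t, and_self]
  · have h1 : (w 0).1 = ⟨δ, 0⟩ := by rw [w0]
    simp only [sub_add_cancel, nrm2, h1]
    rw [zero_pow two_ne_zero, add_zero, Real.sqrt_sq hδ.le]
    linarith
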